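/- arXiv:0803.0477 — 10 statements merged into one kernel-verified Lean document; each statement's English description precedes it below -/
import Mathlib

section
/- For every integer base q ≥ 2 and every positive integer k, there exists a positive integer N that is a multiple of k and whose sum of digits in base q equals k (i.e., s_q(N) = k). Consequently the smallest such multiple a_k is well defined for every k. -/
/-- `digSum q n` is the sum of the digits of `n` written in base `q`. -/
def digSum (q n : ℕ) : ℕ := (Nat.digits q n).sum

theorem digSum_base_mul {q : ℕ} (hq : 2 ≤ q) (n : ℕ) : digSum q (q * n) = digSum q n := by
  rcases Nat.eq_zero_or_pos n with rfl | hn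
  · simp
  · simp [digSum, Nat.digits_base_mul (show 1 < q by omega) hn]

theorem digSum_base_pow_mul {q : ℕ} (hq : 2 ≤ q) (e n : ℕ) :
    digSum q (q ^ e * n) = digSum q n := by
  induction e with
  | zero => simp
  | succ e ih => rw [pow_succ', mul_assoc, digSum_base_mul hq, ih]

theorem digSum_one_add_base_mul {q : ℕ} (hq : 2 ≤ q) (n : ℕ) :
    digSum q (1 + q * n) = 1 + digSum q n := by
  simp [digSum, Nat.digits_add q (by omega) 1 n (by omega) (by simp)]

theorem exists_pow_add_modEq_pow (q : ℕ) {k : ℕ} (hk : 0 < k) :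
    ∃ a d : ℕ, q ^ (a + (d + 1)) ≡ q ^ a [MOD k] := by
  have : NeZero k := ⟨hk.ne'⟩
  obtain ⟨m, n, hmn, h⟩ :=
    Finite.exists_ne_map_eq_of_infinite fun i : ℕ => ((q ^ i : ℕ) : ZMod k)
  have h' : q ^ m ≡ q ^ n [MOD k] := (ZMod.natCast_eq_natCast_iff _ _ _).1 h
  rcases hmn.lt_or_gt with hlt | hlt
  · obtain ⟨d, rfl⟩ := Nat.exists_eq_add_of_lt hlt
    exact ⟨m, d, h'.symm⟩
  · obtain ⟨d, rfl⟩ := Nat.exists_eq_add_of_lt hlt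
    exact ⟨n, d, h'⟩

/-- If `q ^ (a + i * (d + 1))` is constant modulo `k`, the sum of `j` such powers is `q ^ a * j`
modulo `k` and has digit sum `j`. -/
theorem exists_digSum_eq_and_modEq {q k a d : ℕ} (hq : 2 ≤ q)
    (h : q ^ (a + (d + 1)) ≡ q ^ a [MOD k]) (j : ℕ) :
    ∃ M : ℕ, digSum q M = j ∧ q ^ a * M ≡ q ^ a * j [MOD k] := by
  induction j with
  | zero => exact ⟨0, by simp [digSum], rfl⟩
  | succ j ih =>
    obtain ⟨M, hM, hmod⟩ := ih
    refine ⟨1 + q * (q ^ d * M), ?_, ?_⟩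
    · rw [digSum_one_add_base_mul hq, digSum_base_pow_mul hq, hM, add_comm]
    · calc q ^ a * (1 + q * (q ^ d * M)) = q ^ a + q ^ (d + 1) * (q ^ a * M) := by ring
        _ ≡ q ^ a + q ^ (d + 1) * (q ^ a * j) [MOD k] := (hmod.mul_left _).add_left _
        _ = q ^ a + q ^ (a + (d + 1)) * j := by ring
        _ ≡ q ^ a + q ^ a * j [MOD k] := (h.mul_right _).add_left _
        _ = q ^ a * (j + 1) := by ring

/-- For every base `q ≥ 2` and every positive integer `k`, there exists a positive
multiple `N` of `k` whose base-`q` digit sum equals `k`. Consequently the minimal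
such multiple is well defined. -/
theorem exists_niven_multiple (q k : ℕ) (hq : 2 ≤ q) (hk : 0 < k) :
    ∃ N : ℕ, 0 < N ∧ k ∣ N ∧ digSum q N = k := by
  obtain ⟨a, d, h⟩ := exists_pow_add_modEq_pow q hk
  obtain ⟨M, hM, hmod⟩ := exists_digSum_eq_and_modEq hq h k
  have hN : digSum q (q ^ a * M) = k := by rw [digSum_base_pow_mul hq, hM]
  refine ⟨q ^ a * M, Nat.pos_of_ne_zero fun h0 => ?_, ?_, hN⟩
  · rw [h0] at hN
    simp [digSum] at hN
    omega
  · exact (hmod.dvd_iff dvd_rfl).2 (dvd_mul_left _ _)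
end

section
/- For every odd integer k > 1 and every integer x with 0 ≤ x ≤ k − 1, there exist exactly n_k distinct integers 0 ≤ i_1 < i_2 < ⋯ < i_{n_k} ≤ n_k + k − 2 such that 2^{i_1} + 2^{i_2} + ⋯ + 2^{i_{n_k}} ≡ x (mod k). In other words, x is a sum modulo k of exactly n_k distinct elements of the set D = {2^i : i = 0, 1, …, n_k + k − 2}. -/
/-- Every `y < 2 ^ n` is a sum of distinct powers `2 ^ i` with `i < n`. -/
theorem exists_subset_range_sum_two_pow (n y : ℕ) (hy : y < 2 ^ n) :
    ∃ T ⊆ Finset.range n, ∑ i ∈ T, 2 ^ i = y := by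
  refine ⟨y.bitIndices.toFinset, fun i hi => ?_, Finset.sum_toFinset_bitIndices_two_pow y⟩
  rw [Finset.mem_range, ← Nat.pow_lt_pow_iff_right (a := 2) one_lt_two]
  exact (Nat.two_pow_le_of_mem_bitIndices (List.mem_toFinset.mp hi)).trans_lt hy

/-- If `2 ^ s - 1` is invertible modulo `k ≤ 2 ^ n` for some `n ≤ s`, then every residue is a sum
of exactly `n` distinct powers of two with exponents below `n + s`. -/
theorem exists_card_eq_sum_two_pow_modEq {k n s : ℕ} (hk : 0 < k) (hkn : k ≤ 2 ^ n) (hns : n ≤ s)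
    (hu : IsUnit ((2 : ZMod k) ^ s - 1)) (x : ℕ) :
    ∃ S : Finset ℕ, S.card = n ∧ (∀ i ∈ S, i < n + s) ∧ (∑ i ∈ S, 2 ^ i) ≡ x [MOD k] := by
  have : NeZero k := ⟨hk.ne'⟩
  obtain ⟨u, hu⟩ := hu
  set z : ZMod k := (↑u⁻¹ : ZMod k) * (x - ∑ i ∈ Finset.range n, 2 ^ i) with hz
  obtain ⟨T, hT, hsum⟩ :=
    exists_subset_range_sum_two_pow n z.val ((ZMod.val_lt z).trans_le hkn)
  have hsum' : ∑ i ∈ T, (2 : ZMod k) ^ i = z := by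
    rw [← ZMod.natCast_zmod_val z, ← hsum]; push_cast; rfl
  have hdisj : Disjoint (Finset.range n \ T) (T.map (addRightEmbedding s)) := by
    rw [Finset.disjoint_left]
    intro i hi hi'
    simp only [Finset.mem_sdiff, Finset.mem_range, Finset.mem_map,
      addRightEmbedding_apply] at hi hi'
    obtain ⟨j, -, rfl⟩ := hi'
    omega
  refine ⟨(Finset.range n \ T) ∪ T.map (addRightEmbedding s), ?_, ?_, ?_⟩
  · rw [Finset.card_union_of_disjoint hdisj, Finset.card_map, Finset.card_sdiff_add_card_eq_card hT,
      Finset.card_range]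
  · intro i hi
    simp only [Finset.mem_union, Finset.mem_sdiff, Finset.mem_range, Finset.mem_map,
      addRightEmbedding_apply] at hi
    rcases hi with hi | ⟨j, hj, rfl⟩
    · omega
    · have := Finset.mem_range.mp (hT hj)
      omega
  · rw [← ZMod.natCast_eq_natCast_iff, Finset.sum_union hdisj, Finset.sum_map]
    push_cast
    have hsd := Finset.sum_sdiff (f := fun i => (2 : ZMod k) ^ i) hT
    have huz : ((2 : ZMod k) ^ s - 1) * z = x - ∑ i ∈ Finset.range n, 2 ^ i := by
      rw [← hu, hz, Units.mul_inv_cancel_left]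
    simp only [addRightEmbedding_apply, pow_add, ← Finset.sum_mul]
    rw [hsum'] at hsd ⊢
    linear_combination hsd + huz

/-- For odd `k ≥ 5` and the least `n` with `k ≤ 2 ^ n`, some `2 ^ s - 1` with `n ≤ s < k` is
invertible modulo `k`. -/
theorem exists_isUnit_two_pow_sub_one {k n : ℕ} (hk : Odd k) (hk5 : 5 ≤ k)
    (hn : IsLeast {n : ℕ | 0 < n ∧ k ≤ 2 ^ n} n) :
    ∃ s, n ≤ s ∧ s < k ∧ IsUnit ((2 : ZMod k) ^ s - 1) := by
  have hnk : n ≤ k - 2 := by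
    refine hn.2 ⟨by omega, ?_⟩
    obtain ⟨m, rfl⟩ := Nat.exists_eq_add_of_le hk5
    have h := Nat.lt_two_pow_self (n := m)
    have : 2 ^ (5 + m - 2) = 8 * 2 ^ m := by
      rw [show 5 + m - 2 = 3 + m by omega, pow_add]; norm_num
    omega
  by_cases hp : k.Prime
  · have : Fact k.Prime := ⟨hp⟩
    by_cases h : (2 : ZMod k) ^ n = 1
    · refine ⟨n + 1, by omega, by omega, ?_⟩
      rw [pow_succ, h]
      norm_num
    · exact ⟨n, le_rfl, by omega, (sub_ne_zero.mpr h).isUnit⟩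
  · have hφ : (2 : ZMod k) ^ k.totient = 1 := by
      have := (ZMod.natCast_eq_natCast_iff _ _ _).mpr
        (Nat.ModEq.pow_totient hk.coprime_two_left)
      simpa using this
    have hφpos : 0 < k.totient := Nat.totient_pos.mpr (by omega)
    have hφlt : k.totient < k := Nat.totient_lt k (by omega)
    have hφne : k.totient ≠ k - 1 := fun h =>
      hp ((Nat.totient_eq_iff_prime (by omega)).mp h)
    have hnφ : n ≤ k.totient := by
      refine hn.2 ⟨hφpos, ?_⟩
      have hd : k ∣ 2 ^ k.totient - 1 :=
        (Nat.modEq_iff_dvd' Nat.one_le_two_pow).mp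
          (Nat.ModEq.pow_totient hk.coprime_two_left).symm
      have h2 : 1 < 2 ^ k.totient := Nat.one_lt_two_pow hφpos.ne'
      have := Nat.le_of_dvd (by omega) hd
      omega
    refine ⟨k.totient + 1, by omega, by omega, ?_⟩
    rw [pow_succ, hφ]
    norm_num

/-- Lemma 1 of the paper: for every odd `k > 1` and every `x` with `0 ≤ x ≤ k - 1`,
`x` is congruent modulo `k` to a sum of exactly `n_k` distinct elements of
`D = {2^i : 0 ≤ i ≤ n_k + k - 2}`, where `n_k` is the smallest positive integer
with `k ≤ 2^(n_k)`. -/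
theorem sum_of_nk_distinct_powers_of_two
    (k : ℕ) (hk : Odd k) (hk1 : 1 < k)
    (nk : ℕ) (hnk : IsLeast {n : ℕ | 0 < n ∧ k ≤ 2 ^ n} nk)
    (x : ℕ) (hx : x ≤ k - 1) :
    ∃ S : Finset ℕ, S.card = nk ∧ (∀ i ∈ S, i ≤ nk + k - 2) ∧
      (∑ i ∈ S, 2 ^ i) ≡ x [MOD k] := by
  by_cases hk5 : 5 ≤ k
  · obtain ⟨s, hns, hsk, hu⟩ := exists_isUnit_two_pow_sub_one hk hk5 hnk
    obtain ⟨S, hcard, hlt, hmod⟩ :=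
      exists_card_eq_sum_two_pow_modEq (by omega) hnk.1.2 hns hu x
    exact ⟨S, hcard, fun i hi => by have := hlt i hi; omega, hmod⟩
  · obtain rfl : k = 3 := by
      obtain ⟨m, rfl⟩ := hk
      omega
    obtain rfl : nk = 2 := by
      have h1 : nk ≤ 2 := hnk.2 ⟨by norm_num, by norm_num⟩
      obtain ⟨h2, h3⟩ := hnk.1
      interval_cases nk <;> omega
    interval_cases x
    · exact ⟨{0, 1}, by decide, by decide, by decide⟩
    · exact ⟨{1, 3}, by decide, by decide, by decide⟩
    · exact ⟨{0, 2}, by decide, by decide, by decide⟩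
end

section
/- For all positive integers k and ℓ, there exists a positive integer n such that (a) the binary digit sum of n·k equals ℓ·k, i.e., s(nk) = ℓk, and (b) n ≤ (2^{ℓk + n_k} − 2^{μ₂(k)}) / k. -/
/-- `binDigitSum n` is the sum of the binary digits of `n`. -/
def binDigitSum (n : ℕ) : ℕ := (Nat.digits 2 n).sum

theorem binDigitSum_zero : binDigitSum 0 = 0 := by simp [binDigitSum]

theorem binDigitSum_eq_mod_add_div (n : ℕ) :
    binDigitSum n = n % 2 + binDigitSum (n / 2) := by
  rcases Nat.eq_zero_or_pos n with rfl | hn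
  · simp [binDigitSum]
  · simp only [binDigitSum]
    rw [Nat.digits_def' one_lt_two hn, List.sum_cons]

/-- Bitwise concatenation adds digit sums. -/
theorem binDigitSum_add_two_pow_mul (D a b : ℕ) (ha : a < 2 ^ D) :
    binDigitSum (a + 2 ^ D * b) = binDigitSum a + binDigitSum b := by
  induction D generalizing a with
  | zero =>
    obtain rfl : a = 0 := by simpa using ha
    simp [binDigitSum_zero]
  | succ D ih =>
    have hexp : 2 ^ (D + 1) * b = 2 * (2 ^ D * b) := by ring
    have hmod : (a + 2 * (2 ^ D * b)) % 2 = a % 2 := by omega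
    have hdiv : (a + 2 * (2 ^ D * b)) / 2 = a / 2 + 2 ^ D * b := by omega
    have ha' : a / 2 < 2 ^ D := by
      rw [pow_succ] at ha
      omega
    rw [binDigitSum_eq_mod_add_div (a + _), binDigitSum_eq_mod_add_div a, hexp, hmod, hdiv,
      ih _ ha', add_assoc]

theorem binDigitSum_two_pow_mul (D b : ℕ) : binDigitSum (2 ^ D * b) = binDigitSum b := by
  simpa [binDigitSum_zero] using binDigitSum_add_two_pow_mul D 0 b (by positivity)

/-- Bitwise complements in `n` binary digits have digit sums adding up to `n`. -/
theorem binDigitSum_add_binDigitSum_of_add_add_one (n a b : ℕ) (h : a + b + 1 = 2 ^ n) :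
    binDigitSum a + binDigitSum b = n := by
  induction n generalizing a b with
  | zero =>
    obtain ⟨rfl, rfl⟩ : a = 0 ∧ b = 0 := by simpa using h
    simp [binDigitSum_zero]
  | succ n ih =>
    rw [pow_succ] at h
    have := ih (a / 2) (b / 2) (by omega)
    rw [binDigitSum_eq_mod_add_div a, binDigitSum_eq_mod_add_div b]
    omega

theorem binDigitSum_two_pow_sub_one (n : ℕ) : binDigitSum (2 ^ n - 1) = n := by
  have h := binDigitSum_add_binDigitSum_of_add_add_one n (2 ^ n - 1) 0
    (by have := Nat.one_le_two_pow (n := n); omega)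
  simpa [binDigitSum_zero] using h

/-- If `q > 1` is odd, then some multiple of `q` with at most `ℓ * q + n` binary digits has
digit sum `ℓ * q`, where `n` is least with `q ≤ 2 ^ n`. -/
theorem Odd.exists_dvd_binDigitSum_eq {q : ℕ} (hodd : Odd q) (hq : 1 < q) {ℓ n : ℕ}
    (hℓ : 0 < ℓ) (hqn : q ≤ 2 ^ n) (hmin : ∀ m, q ≤ 2 ^ m → n ≤ m) :
    ∃ M, q ∣ M ∧ M < 2 ^ (ℓ * q + n) ∧ binDigitSum M = ℓ * q := by
  set d := q.totient
  set L := ℓ * q + n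
  have hd : 2 ^ d ≡ 1 [MOD q] := Nat.ModEq.pow_totient hodd.coprime_two_left
  have hd_pos : 0 < d := Nat.totient_pos.2 (by omega)
  have hdq : d < q := Nat.totient_lt q hq
  have hq_lt : q ≤ 2 ^ d := by
    have hdvd : q ∣ 2 ^ d - 1 := (Nat.modEq_iff_dvd' Nat.one_le_two_pow).1 hd.symm
    have hlt : 1 < 2 ^ d := Nat.one_lt_two_pow hd_pos.ne'
    have := Nat.le_of_dvd (by omega) hdvd
    omega
  have hnd : n ≤ d := hmin d hq_lt
  have hDL : d + 1 + n ≤ L := by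
    have : q ≤ ℓ * q := Nat.le_mul_of_pos_left q hℓ
    omega
  have hnL : 2 ^ n ≤ 2 ^ L := Nat.pow_le_pow_right two_pos (by omega)
  have hnD : 2 ^ n ≤ 2 ^ (d + 1) := Nat.pow_le_pow_right two_pos (by omega)
  set r := (2 ^ L - 2 ^ n) % q
  have hrn : r < 2 ^ n := (Nat.mod_lt _ (by omega)).trans_le hqn
  obtain ⟨A, hA⟩ : ∃ A, A + r + 1 = 2 ^ n := ⟨2 ^ n - 1 - r, by omega⟩
  have hTL : A + 2 ^ (d + 1) * r + 1 ≤ 2 ^ L := by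
    calc A + 2 ^ (d + 1) * r + 1 ≤ 2 ^ (d + 1) * (r + 1) := by rw [mul_add]; omega
      _ ≤ 2 ^ (d + 1) * 2 ^ n := Nat.mul_le_mul_left _ hrn
      _ = 2 ^ (d + 1 + n) := (pow_add _ _ _).symm
      _ ≤ 2 ^ L := Nat.pow_le_pow_right two_pos hDL
  have hsT : binDigitSum (A + 2 ^ (d + 1) * r) = n := by
    rw [binDigitSum_add_two_pow_mul _ _ _ (by omega),
      binDigitSum_add_binDigitSum_of_add_add_one n A r hA]
  obtain ⟨M, hM⟩ : ∃ M, M + (A + 2 ^ (d + 1) * r) + 1 = 2 ^ L :=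
    ⟨2 ^ L - 1 - (A + 2 ^ (d + 1) * r), by omega⟩
  have hsM := binDigitSum_add_binDigitSum_of_add_add_one L _ _ hM
  refine ⟨M, ?_, by omega, by omega⟩
  have hmod : A + 2 ^ (d + 1) * r + 1 ≡ 2 ^ L [MOD q] := by
    calc A + 2 ^ (d + 1) * r + 1 = A + 1 + 2 ^ d * (2 * r) := by ring
      _ ≡ A + 1 + 1 * (2 * r) [MOD q] := (hd.mul_right _).add_left _
      _ = 2 ^ n + r := by omega
      _ ≡ 2 ^ n + (2 ^ L - 2 ^ n) [MOD q] := (Nat.mod_modEq _ _).add_left _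
      _ = 2 ^ L := by omega
  have hdvd := (Nat.modEq_iff_dvd' hTL).1 hmod
  rwa [show 2 ^ L - (A + 2 ^ (d + 1) * r + 1) = M by omega] at hdvd

/-- Theorem 3 of the paper: for all positive integers `k` and `ℓ` there is a positive
integer `n` with `s(nk) = ℓk` and `n ≤ (2^(ℓk + n_k) - 2^(μ₂(k)))/k`, where `n_k`
is the smallest positive integer with `k ≤ 2^(n_k)` and `μ₂(k)` is the exponent of
`2` in `k`.  (The bound on `n` is stated in the equivalent multiplied-out form
`n * k ≤ 2^(ℓk + n_k) - 2^(μ₂(k))`.) -/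
theorem exists_multiple_with_binary_digit_sum
    (k ℓ : ℕ) (hk : 0 < k) (hℓ : 0 < ℓ)
    (nk : ℕ) (hnk : IsLeast {n : ℕ | 0 < n ∧ k ≤ 2 ^ n} nk) :
    ∃ n : ℕ, 0 < n ∧ binDigitSum (n * k) = ℓ * k ∧
      n * k ≤ 2 ^ (ℓ * k + nk) - 2 ^ (padicValNat 2 k) := by
  obtain ⟨⟨-, hk_le⟩, hmin⟩ := hnk
  set μ := padicValNat 2 k
  obtain ⟨q, hkq⟩ : 2 ^ μ ∣ k := pow_padicValNat_dvd
  have hq_odd : Odd q := by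
    rw [← Nat.not_even_iff_odd, even_iff_two_dvd]
    rintro ⟨c, rfl⟩
    refine pow_succ_padicValNat_not_dvd (p := 2) hk.ne' ⟨c, ?_⟩
    rw [pow_succ, mul_assoc]
    exact hkq
  have hμ : μ ≤ nk := (Nat.pow_le_pow_iff_right one_lt_two).1 <|
    (Nat.le_of_dvd hk pow_padicValNat_dvd).trans hk_le
  have hL : ℓ * k + nk = μ + (ℓ * 2 ^ μ * q + (nk - μ)) := by
    rw [mul_assoc, ← hkq]
    omega
  obtain ⟨M, ⟨c, rfl⟩, hM_lt, hM_sum⟩ :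
      ∃ M, q ∣ M ∧ M < 2 ^ (ℓ * 2 ^ μ * q + (nk - μ)) ∧ binDigitSum M = ℓ * 2 ^ μ * q := by
    rcases (Nat.succ_le_of_lt hq_odd.pos).eq_or_lt with hq | hq
    · obtain rfl : q = 1 := hq.symm
      refine ⟨2 ^ (ℓ * 2 ^ μ * 1) - 1, one_dvd _, ?_, binDigitSum_two_pow_sub_one _⟩
      exact (Nat.sub_lt (by positivity) one_pos).trans_le
        (Nat.pow_le_pow_right two_pos (Nat.le_add_right _ _))
    · refine hq_odd.exists_dvd_binDigitSum_eq hq (by positivity) ?_ fun m hm => ?_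
      · refine le_of_mul_le_mul_left (a := 2 ^ μ) ?_ (by positivity)
        rwa [← hkq, ← pow_add, Nat.add_sub_cancel' hμ]
      · have hm_pos : 0 < m := by
          rcases Nat.eq_zero_or_pos m with rfl | h
          · simp at hm
            omega
          · exact h
        have := hmin (show 0 < μ + m ∧ k ≤ 2 ^ (μ + m) from
          ⟨by omega, by rw [hkq, pow_add]; exact Nat.mul_le_mul_left _ hm⟩)
        omega
  have hck : c * k = 2 ^ μ * (q * c) := by
    rw [hkq]
    ring
  have hsum : binDigitSum (c * k) = ℓ * k := by
    rw [hck, binDigitSum_two_pow_mul, hM_sum, mul_assoc, ← hkq]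
  refine ⟨c, Nat.pos_of_ne_zero ?_, hsum, ?_⟩
  · rintro rfl
    rw [zero_mul, binDigitSum_zero] at hsum
    exact (Nat.mul_pos hℓ hk).ne hsum
  · rw [hck, hL, pow_add, ← Nat.mul_sub_one]
    exact Nat.mul_le_mul_left _ (by omega)
end

section
/- For every positive integer m, the set 𝒞_m is contained in 𝒞_{m+1}: if an odd positive integer k satisfies 2^{k+m} − 1 ≡ 2^{j_1} + ⋯ + 2^{j_m} (mod k) for some 0 ≤ j_1 < ⋯ < j_m ≤ m + k − 2, then it also satisfies 2^{k+m+1} − 1 ≡ 2^{j'_1} + ⋯ + 2^{j'_{m+1}} (mod k) for some 0 ≤ j'_1 < ⋯ < j'_{m+1} ≤ (m+1) + k − 2. -/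
/-- `memC m k` says that the odd positive integer `k` belongs to the set `𝒞_m`:
`2^(k+m) - 1` is congruent modulo `k` to a sum of `m` distinct powers of two
`2^(j_1) + ⋯ + 2^(j_m)` with `0 ≤ j_1 < ⋯ < j_m ≤ m + k - 2`. -/
def memC (m k : ℕ) : Prop :=
  Odd k ∧ 0 < k ∧ ∃ S : Finset ℕ, S.card = m ∧ (∀ j ∈ S, j ≤ m + k - 2) ∧
    2 ^ (k + m) - 1 ≡ (∑ j ∈ S, 2 ^ j) [MOD k]

/-- For every positive integer `m`, the set `𝒞_m` is contained in `𝒞_{m+1}`. -/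
theorem C_subset_C_succ (m : ℕ) (hm : 0 < m) (k : ℕ) (hk : memC m k) :
    memC (m + 1) k := by
  obtain ⟨hodd, hpos, S, hcard, hle, hmod⟩ := hk
  have h0 : 0 ∉ S.map (addRightEmbedding 1) := by simp
  refine ⟨hodd, hpos, insert 0 (S.map (addRightEmbedding 1)), ?_, ?_, ?_⟩
  · rw [Finset.card_insert_of_notMem h0, Finset.card_map, hcard]
  · intro j hj
    simp only [Finset.mem_insert, Finset.mem_map, addRightEmbedding_apply] at hj
    obtain rfl | ⟨i, hi, rfl⟩ := hj
    · exact Nat.zero_le _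
    · have := hle i hi
      omega
  · have hpow : 2 ^ (k + (m + 1)) - 1 = 1 + 2 * (2 ^ (k + m) - 1) := by
      have := Nat.one_le_two_pow (n := k + m)
      rw [← add_assoc, pow_succ]
      omega
    have hsum : ∑ j ∈ insert 0 (S.map (addRightEmbedding 1)), 2 ^ j
        = 1 + 2 * ∑ j ∈ S, 2 ^ j := by
      rw [Finset.sum_insert h0, Finset.sum_map, Finset.mul_sum]
      simp [pow_succ, mul_comm]
    rw [hpow, hsum]
    exact (hmod.mul_left 2).add_left 1
end

section
/- Every odd integer k ≥ 3 belongs to 𝒞_{n_k}, where n_k = ⌈log k / log 2⌉ is the smallest positive integer with k ≤ 2^{n_k}. Consequently, every odd positive integer belongs to 𝒞_m for some positive integer m. -/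
/-- Trade the exponents in `X` for copies of the exponents in `Y` shifted by `φ(k)`,
starting from `2^0 + ⋯ + 2^(m-1)`. -/
theorem memC_of_exchange {m k : ℕ} (hk : Odd k) (hk1 : 1 < k) (hm : m ≤ k.totient)
    {X Y : Finset ℕ} (hX : X ⊆ Finset.range m) (hY : Y ⊆ Finset.range m)
    (hcard : X.card = Y.card)
    (hmod : 2 ^ (k + m) + ∑ j ∈ X, 2 ^ j ≡ 2 ^ m + ∑ j ∈ Y, 2 ^ j [MOD k]) :
    memC m k := by
  have hlt := Nat.totient_lt k hk1
  have hdisj : Disjoint (Finset.range m \ X) (Y.map (addRightEmbedding k.totient)) := by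
    rw [Finset.disjoint_left]
    intro a ha hb
    simp only [Finset.mem_sdiff, Finset.mem_range, Finset.mem_map,
      addRightEmbedding_apply] at ha hb
    obtain ⟨b, -, rfl⟩ := hb
    omega
  refine ⟨hk, by omega, (Finset.range m \ X) ∪ Y.map (addRightEmbedding k.totient), ?_, ?_, ?_⟩
  · rw [Finset.card_union_of_disjoint hdisj, Finset.card_map, ← hcard,
      Finset.card_sdiff_add_card_eq_card hX, Finset.card_range]
  · intro j hj
    simp only [Finset.mem_union, Finset.mem_sdiff, Finset.mem_range, Finset.mem_map,
      addRightEmbedding_apply] at hj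
    rcases hj with ⟨hj, -⟩ | ⟨b, hb, rfl⟩
    · omega
    · have := Finset.mem_range.mp (hY hb)
      omega
  · have htot : (2 : ZMod k) ^ k.totient = 1 := by
      have h := (ZMod.natCast_eq_natCast_iff _ _ _).mpr
        (Nat.ModEq.pow_totient (Nat.coprime_two_left.mpr hk))
      push_cast at h
      exact h
    have hgeom : ∑ j ∈ Finset.range m, (2 : ZMod k) ^ j = 2 ^ m - 1 := by
      have h := geom_sum_mul (2 : ZMod k) m
      linear_combination h
    rw [← ZMod.natCast_eq_natCast_iff] at hmod ⊢
    rw [Finset.sum_union hdisj, Finset.sum_map, Nat.cast_sub Nat.one_le_two_pow]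
    have hsd := Finset.sum_sdiff (f := fun j => (2 : ZMod k) ^ j) hX
    rw [hgeom] at hsd
    push_cast at hmod ⊢
    simp only [addRightEmbedding_apply, pow_add _ _ k.totient, htot, mul_one]
    linear_combination hmod - hsd

theorem exists_sum_two_pow_eq {n x : ℕ} (hx : x < 2 ^ n) :
    ∃ T ⊆ Finset.range n, ∑ j ∈ T, 2 ^ j = x := by
  refine ⟨x.bitIndices.toFinset, fun j hj => ?_, Finset.sum_toFinset_bitIndices_two_pow x⟩
  have h := Nat.two_pow_le_of_mem_bitIndices (List.mem_toFinset.mp hj)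
  exact Finset.mem_range.mpr ((Nat.pow_lt_pow_iff_right one_lt_two).mp (h.trans_lt hx))

theorem le_totient_of_two_pow_lt {n k : ℕ} (hk : Odd k) (hk1 : 1 < k) (h : 2 ^ n < k) :
    n + 1 ≤ k.totient := by
  have hpos : 0 < k.totient := Nat.totient_pos.mpr (by omega)
  have hdvd : k ∣ 2 ^ k.totient - 1 :=
    (Nat.modEq_iff_dvd' Nat.one_le_two_pow).mp
      (Nat.ModEq.pow_totient (Nat.coprime_two_left.mpr hk)).symm
  have hgt : 1 < 2 ^ k.totient := Nat.one_lt_two_pow hpos.ne'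
  have hle := Nat.le_of_dvd (by omega) hdvd
  exact (Nat.pow_lt_pow_iff_right one_lt_two).mp (show 2 ^ n < 2 ^ k.totient by omega)

theorem memC_succ {n k : ℕ} (hk : Odd k) (hk1 : 1 < k) (hlo : 2 ^ n < k)
    (hhi : k ≤ 2 ^ (n + 1)) : memC (n + 1) k := by
  have hm := le_totient_of_two_pow_lt hk hk1 hlo
  obtain ⟨v, hv⟩ : ∃ v : ℤ, v = Int.bmod (2 ^ (k + (n + 1)) - 2 ^ (n + 1)) k := ⟨_, rfl⟩
  have hvmod : (v : ZMod k) = 2 ^ (k + (n + 1)) - 2 ^ (n + 1) := by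
    have h : v ≡ 2 ^ (k + (n + 1)) - 2 ^ (n + 1) [ZMOD k] := by
      rw [hv]; exact Int.bmod_emod
    have h' := (ZMod.intCast_eq_intCast_iff _ _ _).mpr h
    push_cast at h'
    exact h'
  have hvabs : v.natAbs < 2 ^ n := by
    have h1 := Int.bmod_lt (x := 2 ^ (k + (n + 1)) - 2 ^ (n + 1)) (m := k) (by omega)
    have h2 := Int.le_bmod (x := 2 ^ (k + (n + 1)) - 2 ^ (n + 1)) (m := k) (by omega)
    rw [← hv] at h1 h2
    obtain ⟨c, hc⟩ := hk
    rw [pow_succ] at hhi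
    omega
  obtain ⟨T, hT, hsum⟩ := exists_sum_two_pow_eq hvabs
  have hsum' : ∑ j ∈ T, (2 : ZMod k) ^ j = (v.natAbs : ZMod k) := by
    rw [← hsum]; push_cast; rfl
  have hT0 : T ⊆ Finset.range (n + 1) := hT.trans (Finset.range_subset_range.mpr n.le_succ)
  have hT1 : T.map (addRightEmbedding 1) ⊆ Finset.range (n + 1) := by
    intro j hj
    obtain ⟨b, hb, rfl⟩ := Finset.mem_map.mp hj
    have := Finset.mem_range.mp (hT hb)
    simpa using this
  have hshift : ∑ j ∈ T.map (addRightEmbedding 1), (2 : ZMod k) ^ j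
      = 2 * (v.natAbs : ZMod k) := by
    simp only [Finset.sum_map, addRightEmbedding_apply, pow_succ, ← Finset.sum_mul, hsum']
    ring
  rcases Int.natAbs_eq v with h | h
  · have hcast : (v : ZMod k) = (v.natAbs : ZMod k) := by
      have h' := congrArg (Int.cast : ℤ → ZMod k) h
      rwa [Int.cast_natCast] at h'
    refine memC_of_exchange hk hk1 hm hT0 hT1 (Finset.card_map _).symm ?_
    rw [← ZMod.natCast_eq_natCast_iff]
    push_cast
    rw [hshift, hsum']
    linear_combination hcast - hvmod
  · have hcast : (v : ZMod k) = -(v.natAbs : ZMod k) := by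
      have h' := congrArg (Int.cast : ℤ → ZMod k) h
      rwa [Int.cast_neg, Int.cast_natCast] at h'
    refine memC_of_exchange hk hk1 hm hT1 hT0 (Finset.card_map _) ?_
    rw [← ZMod.natCast_eq_natCast_iff]
    push_cast
    rw [hshift, hsum']
    linear_combination hcast - hvmod

theorem memC_of_isLeast {k m : ℕ} (hk : Odd k) (hk3 : 3 ≤ k)
    (hm : IsLeast {n : ℕ | 0 < n ∧ k ≤ 2 ^ n} m) : memC m k := by
  obtain ⟨⟨hpos, hle⟩, hmin⟩ := hm
  obtain ⟨n, rfl⟩ := Nat.exists_eq_succ_of_ne_zero hpos.ne'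
  refine memC_succ hk (by omega) ?_ hle
  by_contra! hcon
  rcases Nat.eq_zero_or_pos n with rfl | hn
  · simp only [pow_zero] at hcon
    omega
  · have := hmin ⟨hn, hcon⟩
    omega

/-- Every odd integer `k ≥ 3` belongs to `𝒞_(n_k)`, where `n_k` is the smallest
positive integer with `k ≤ 2^(n_k)`; consequently every odd positive integer
belongs to `𝒞_m` for some positive integer `m`. -/
theorem odd_mem_C_nk :
    (∀ k nk : ℕ, Odd k → 3 ≤ k →
      IsLeast {n : ℕ | 0 < n ∧ k ≤ 2 ^ n} nk → memC nk k) ∧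
    (∀ k : ℕ, Odd k → 0 < k → ∃ m : ℕ, 0 < m ∧ memC m k) := by
  refine ⟨fun k nk hk hk3 h => memC_of_isLeast hk hk3 h, fun k hk hpos => ?_⟩
  rcases lt_or_ge k 3 with hlt | hk3
  · have hk1 : k = 1 := by
      obtain ⟨c, hc⟩ := hk
      omega
    subst hk1
    exact ⟨1, one_pos, hk, one_pos, {0}, by simp, by simp, Nat.modEq_one⟩
  · have hne : ∃ n : ℕ, 0 < n ∧ k ≤ 2 ^ n := ⟨k, hpos, Nat.lt_two_pow_self.le⟩
    classical
    exact ⟨Nat.find hne, (Nat.find_spec hne).1, memC_of_isLeast hk hk3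
      ⟨Nat.find_spec hne, fun n hn => Nat.find_min' hne hn⟩⟩
end

section
/- For every odd integer k > 1 belonging to 𝒞_1 (that is, 2^{k+1} − 1 ≡ 2^j (mod k) for some integer 0 ≤ j ≤ k − 1), the minimal binary Niven number a_k satisfies 2^k − 1 < a_k < 2^{k+1} − 1. -/
theorem two_pow_binDigitSum_le (n : ℕ) : 2 ^ binDigitSum n ≤ n + 1 := by
  induction n using Nat.strong_induction_on with
  | _ n ih =>
    rcases Nat.eq_zero_or_pos n with rfl | hn
    · simp [binDigitSum_zero]
    · have h := ih (n / 2) (by omega)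
      rw [binDigitSum_eq_mod_add_div, pow_add]
      rcases Nat.mod_two_eq_zero_or_one n with h2 | h2 <;> rw [h2] <;> omega

theorem binDigitSum_two_pow (j : ℕ) : binDigitSum (2 ^ j) = 1 := by
  induction j with
  | zero => simp [binDigitSum]
  | succ j ih =>
    rw [binDigitSum_eq_mod_add_div, pow_succ, Nat.mul_mod_left,
      Nat.mul_div_cancel _ two_pos, ih]

theorem binDigitSum_add_binDigitSum_compl (m x : ℕ) (hx : x < 2 ^ m) :
    binDigitSum x + binDigitSum (2 ^ m - 1 - x) = m := by
  induction m generalizing x with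
  | zero =>
    obtain rfl : x = 0 := by simpa using hx
    simp [binDigitSum_zero]
  | succ m ih =>
    rw [pow_succ] at hx ⊢
    have h := ih (x / 2) (by omega)
    rw [binDigitSum_eq_mod_add_div x, binDigitSum_eq_mod_add_div (2 ^ m * 2 - 1 - x),
      show (2 ^ m * 2 - 1 - x) / 2 = 2 ^ m - 1 - x / 2 by omega]
    omega

theorem coprime_minFac_sub_one (k : ℕ) (hk : k ≠ 1) : Nat.Coprime k (k.minFac - 1) := by
  have hp := (Nat.minFac_prime hk).two_le
  refine Nat.coprime_of_dvd fun q hq hqk hqp => ?_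
  have h1 := Nat.minFac_le_of_dvd hq.two_le hqk
  have h2 := Nat.le_of_dvd (by omega) hqp
  omega

theorem not_dvd_two_pow_self_sub_one (k : ℕ) (hk : Odd k) (hk1 : 1 < k) :
    ¬ k ∣ 2 ^ k - 1 := by
  intro h
  have hp := Nat.minFac_prime hk1.ne'
  have hcop : Nat.Coprime 2 k.minFac :=
    (Nat.coprime_two_left.2 hk).coprime_dvd_right k.minFac_dvd
  have hfermat : k.minFac ∣ 2 ^ (k.minFac - 1) - 1 := by
    have := Nat.ModEq.pow_totient hcop
    rw [Nat.totient_prime hp] at this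
    exact (Nat.modEq_iff_dvd' Nat.one_le_two_pow).1 this.symm
  have hgcd := Nat.dvd_gcd (k.minFac_dvd.trans h) hfermat
  rw [Nat.pow_sub_one_gcd_pow_sub_one, coprime_minFac_sub_one k hk1.ne'] at hgcd
  exact hp.one_lt.ne' (Nat.dvd_one.1 (by simpa using hgcd))

/-- Theorem (𝒞₁ bounds): for every odd `k > 1` in `𝒞₁`, the minimal binary Niven
number `a_k` (smallest positive multiple of `k` with binary digit sum `k`)
satisfies `2^k - 1 < a_k < 2^(k+1) - 1`. -/
theorem ak_bounds_of_mem_C1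
    (k : ℕ) (hk : Odd k) (hk1 : 1 < k) (hC1 : memC 1 k)
    (a : ℕ) (ha : IsLeast {N : ℕ | 0 < N ∧ k ∣ N ∧ binDigitSum N = k} a) :
    2 ^ k - 1 < a ∧ a < 2 ^ (k + 1) - 1 := by
  obtain ⟨⟨ha0, hka, hsum⟩, hmin⟩ := ha
  constructor
  · have hle := two_pow_binDigitSum_le a
    rw [hsum] at hle
    refine lt_of_le_of_ne (by omega) fun h => ?_
    exact not_dvd_two_pow_self_sub_one k hk hk1 (h ▸ hka)
  · obtain ⟨-, -, S, hS, hle, hmod⟩ := hC1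
    obtain ⟨j, rfl⟩ := Finset.card_eq_one.1 hS
    have hj : j ≤ k - 1 := by
      have := hle j (Finset.mem_singleton_self j)
      omega
    rw [Finset.sum_singleton] at hmod
    have hjk : 2 ^ j < 2 ^ k := Nat.pow_lt_pow_right one_lt_two (by omega)
    have hpos : 0 < 2 ^ j := by positivity
    have hsucc : 2 ^ (k + 1) = 2 ^ k * 2 := pow_succ 2 k
    have hcompl := binDigitSum_add_binDigitSum_compl (k + 1) (2 ^ j) (by omega)
    rw [binDigitSum_two_pow] at hcompl
    have hmem := hmin (a := 2 ^ (k + 1) - 1 - 2 ^ j)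
      ⟨by omega, (Nat.modEq_iff_dvd' (by omega)).1 hmod.symm, by omega⟩
    omega
end

section
/- Let k > 1 be an odd integer in 𝒞_1, let t_k be the multiplicative order of 2 modulo k, and let j_0 ∈ {0, 1, …, t_k − 1} be such that 2^{k+1} − 1 ≡ 2^{j_0} (mod k). Set s = ⌊(k − 1 − j_0)/t_k⌋ and j_1 = j_0 + s·t_k. Then a_k = 2^{k+1} − 1 − 2^{j_1}. -/
theorem binDigitSum_compl_add {n a : ℕ} (h : a < 2 ^ n) :
    binDigitSum (2 ^ n - 1 - a) + binDigitSum a = n := by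
  induction n generalizing a with
  | zero =>
    obtain rfl : a = 0 := by simpa using h
    simp [binDigitSum]
  | succ n ih =>
    rw [pow_succ] at h
    have hdiv : (2 ^ (n + 1) - 1 - a) / 2 = 2 ^ n - 1 - a / 2 := by
      rw [pow_succ]; omega
    have hmod : (2 ^ (n + 1) - 1 - a) % 2 + a % 2 = 1 := by
      rw [pow_succ]; omega
    have hrec := ih (a := a / 2) (by omega)
    rw [binDigitSum_eq_mod_add_div (2 ^ (n + 1) - 1 - a), binDigitSum_eq_mod_add_div a, hdiv]
    omega

theorem eq_zero_of_binDigitSum_eq_zero {n : ℕ} (h : binDigitSum n = 0) : n = 0 := by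
  induction n using Nat.strong_induction_on with
  | _ n ih =>
    rw [binDigitSum_eq_mod_add_div] at h
    by_contra hn
    have := ih (n / 2) (by omega) (by omega)
    omega

theorem exists_eq_two_pow_of_binDigitSum_eq_one {n : ℕ} (h : binDigitSum n = 1) :
    ∃ j, n = 2 ^ j := by
  induction n using Nat.strong_induction_on with
  | _ n ih =>
    have hn : n ≠ 0 := by rintro rfl; simp [binDigitSum] at h
    rw [binDigitSum_eq_mod_add_div] at h
    rcases Nat.mod_two_eq_zero_or_one n with h0 | h1
    · obtain ⟨j, hj⟩ := ih (n / 2) (by omega) (by omega)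
      exact ⟨j + 1, by rw [pow_succ]; omega⟩
    · have := eq_zero_of_binDigitSum_eq_zero (n := n / 2) (by omega)
      exact ⟨0, by rw [pow_zero]; omega⟩

theorem two_pow_self_not_modEq_one {k : ℕ} (hk1 : 1 < k) :
    ¬ 2 ^ k ≡ 1 [MOD k] := by
  intro h
  have hp : k.minFac.Prime := Nat.minFac_prime hk1.ne'
  have : Fact k.minFac.Prime := ⟨hp⟩
  have hpow : (2 : ZMod k.minFac) ^ k = 1 := by
    have := (ZMod.natCast_eq_natCast_iff _ _ _).2 (h.of_dvd (Nat.minFac_dvd k))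
    simpa using this
  have h2 : (2 : ZMod k.minFac) ≠ 0 := by
    intro h2
    rw [h2, zero_pow (by omega)] at hpow
    exact zero_ne_one hpow
  have hcop : Nat.Coprime k (k.minFac - 1) := by
    refine Nat.coprime_of_dvd fun q hq hqk hqp => ?_
    have h1 := Nat.minFac_le_of_dvd hq.two_le hqk
    have h3 := Nat.le_of_dvd (Nat.sub_pos_of_lt hp.one_lt) hqp
    have := hp.two_le
    omega
  have hone := pow_gcd_eq_one.2 ⟨hpow, ZMod.pow_card_sub_one_eq_one h2⟩
  rw [hcop.gcd_eq_one, pow_one] at hone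
  have h0 : (1 : ZMod k.minFac) = 0 := by linear_combination hone
  exact one_ne_zero h0

theorem orderOf_two_eq_of_isLeast {k t : ℕ}
    (ht : IsLeast {u : ℕ | 0 < u ∧ 2 ^ u ≡ 1 [MOD k]} t) :
    orderOf (2 : ZMod k) = t := by
  have hiff (u : ℕ) : 2 ^ u ≡ 1 [MOD k] ↔ (2 : ZMod k) ^ u = 1 := by
    rw [← ZMod.natCast_eq_natCast_iff]; simp
  rw [orderOf_eq_iff ht.1.1]
  refine ⟨(hiff t).1 ht.1.2, fun m hm hm0 h => ?_⟩
  exact absurd (ht.2 ⟨hm0, (hiff m).2 h⟩) (by omega)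

theorem modEq_of_two_pow_modEq {k t i j : ℕ}
    (ht : IsLeast {u : ℕ | 0 < u ∧ 2 ^ u ≡ 1 [MOD k]} t) (h : 2 ^ i ≡ 2 ^ j [MOD k]) :
    i ≡ j [MOD t] := by
  have hord := orderOf_two_eq_of_isLeast ht
  have hfin : IsOfFinOrder (2 : ZMod k) := orderOf_pos_iff.1 (hord ▸ ht.1.1)
  rw [← hord, ← hfin.pow_eq_pow_iff_modEq]
  have := (ZMod.natCast_eq_natCast_iff _ _ _).2 h
  simpa using this

theorem le_add_div_mul_of_modEq {m t i j : ℕ} (ht : 0 < t) (hj : j ≤ m) (h : j ≡ i [MOD t]) :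
    j ≤ i + (m - i) / t * t := by
  rcases le_total j i with hji | hij
  · exact hji.trans (Nat.le_add_right _ _)
  · obtain ⟨c, hc⟩ := (Nat.modEq_iff_dvd' hij).1 h.symm
    have hle : c ≤ (m - i) / t := by
      rw [Nat.le_div_iff_mul_le ht, mul_comm, ← hc]
      omega
    have := Nat.mul_le_mul_right t hle
    rw [mul_comm c t, ← hc] at this
    omega

/-- Closed formula for `a_k` when `k ∈ 𝒞₁`: if `k > 1` is odd and lies in `𝒞₁`,
`t` is the multiplicative order of `2` modulo `k`, and `0 ≤ j₀ ≤ t - 1` satisfies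
`2^(k+1) - 1 ≡ 2^(j₀) (mod k)`, then setting `s = ⌊(k - 1 - j₀)/t⌋` and
`j₁ = j₀ + s·t`, the minimal binary Niven number is `a_k = 2^(k+1) - 1 - 2^(j₁)`. -/
theorem ak_formula_of_mem_C1
    (k : ℕ) (hk : Odd k) (hk1 : 1 < k) (hC1 : memC 1 k)
    (t : ℕ) (ht : IsLeast {u : ℕ | 0 < u ∧ 2 ^ u ≡ 1 [MOD k]} t)
    (j0 : ℕ) (hj0 : j0 < t) (hcong : 2 ^ (k + 1) - 1 ≡ 2 ^ j0 [MOD k])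
    (a : ℕ) (ha : IsLeast {N : ℕ | 0 < N ∧ k ∣ N ∧ binDigitSum N = k} a) :
    a = 2 ^ (k + 1) - 1 - 2 ^ (j0 + ((k - 1 - j0) / t) * t) := by
  have htk : t < k := by
    have hle : t ≤ k.totient := ht.2 ⟨Nat.totient_pos.2 (by omega),
      Nat.ModEq.pow_totient (Nat.coprime_two_left.2 hk)⟩
    exact hle.trans_lt (Nat.totient_lt k hk1)
  set j1 := j0 + ((k - 1 - j0) / t) * t with hj1
  have hj1k : j1 < k := by
    have := Nat.div_mul_le_self (k - 1 - j0) t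
    omega
  have h2t : 2 ^ t ≡ 1 [MOD k] := ht.1.2
  have hcong1 : 2 ^ j1 ≡ 2 ^ (k + 1) - 1 [MOD k] := by
    have h1 : 2 ^ (((k - 1 - j0) / t) * t) ≡ 1 [MOD k] := by
      rw [mul_comm, pow_mul]
      simpa using h2t.pow ((k - 1 - j0) / t)
    rw [hj1, pow_add]
    simpa using (h1.mul_left (2 ^ j0)).trans (by simpa using hcong.symm)
  have hpow1 : 2 ^ j1 < 2 ^ k := Nat.pow_lt_pow_right (by norm_num) hj1k
  have hsucc : 2 ^ (k + 1) = 2 ^ k * 2 := pow_succ 2 k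
  have hk2 : 1 < 2 ^ k := Nat.one_lt_two_pow (by omega)
  have hmem : 2 ^ (k + 1) - 1 - 2 ^ j1 ∈ {N : ℕ | 0 < N ∧ k ∣ N ∧ binDigitSum N = k} := by
    refine ⟨by omega, (Nat.modEq_iff_dvd' (by omega)).1 hcong1, ?_⟩
    have := binDigitSum_compl_add (n := k + 1) (a := 2 ^ j1) (by omega)
    rw [binDigitSum_two_pow] at this
    omega
  have hale : a ≤ 2 ^ (k + 1) - 1 - 2 ^ j1 := ha.2 hmem
  have halt : a < 2 ^ (k + 1) - 1 := hale.trans_lt (Nat.sub_lt (by omega) (by positivity))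
  obtain ⟨ha0, hka, hsum⟩ := ha.1
  obtain ⟨j, hj⟩ : ∃ j, 2 ^ (k + 1) - 1 - a = 2 ^ j := by
    apply exists_eq_two_pow_of_binDigitSum_eq_one
    have := binDigitSum_compl_add (n := k + 1) (a := a) (by omega)
    omega
  have hjk : j < k + 1 := (Nat.pow_lt_pow_iff_right (a := 2) (by norm_num)).1 (by omega)
  have hjne : j ≠ k := by
    rintro rfl
    have hsub : 2 ^ j - 1 = a := by omega
    exact two_pow_self_not_modEq_one hk1
      ((Nat.modEq_iff_dvd' (by omega)).2 (hsub ▸ hka)).symm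
  have hcongj : 2 ^ j ≡ 2 ^ (k + 1) - 1 [MOD k] := by
    refine (Nat.modEq_iff_dvd' (by omega)).2 ?_
    rwa [← hj, Nat.sub_sub_self (by omega)]
  have hjj1 : j ≤ j1 := le_add_div_mul_of_modEq ht.1.1 (by omega)
    (modEq_of_two_pow_modEq ht (hcongj.trans hcong))
  have := Nat.pow_le_pow_right (n := 2) two_pos hjj1
  omega
end

section
/- Let k = 2^i − 1 be a Mersenne prime with i ≥ 2. Then k belongs to 𝒞_i but does not belong to 𝒞_{i−1}. -/
/-- A nonempty sum of powers of two that is divisible by `2 ^ i - 1` has at least `i` terms. -/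
theorem le_card_of_two_pow_sub_one_dvd_sum (i : ℕ) (hi : 1 ≤ i) (M : Multiset ℕ) (hM : M ≠ 0)
    (hdvd : 2 ^ i - 1 ∣ (M.map (2 ^ ·)).sum) : i ≤ M.card := by
  induction h : (M.map (2 ^ ·)).sum + M.card using Nat.strong_induction_on generalizing M with
  | _ n ih =>
  by_cases hnd : M.Nodup
  · by_cases hlt : ∀ j ∈ M, j < i
    · lift M to Finset ℕ using hnd
      have hsub : M ⊆ Finset.range i := fun j hj => Finset.mem_range.2 (hlt j hj)
      change 2 ^ i - 1 ∣ ∑ j ∈ M, 2 ^ j at hdvd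
      change i ≤ M.card
      have hne : M.Nonempty := Finset.nonempty_iff_ne_empty.2 fun h0 => hM (by simp [h0])
      have hpos : 0 < ∑ j ∈ M, 2 ^ j := Finset.sum_pos (fun j _ => by positivity) hne
      have hle := Nat.le_of_dvd hpos hdvd
      have hgeom : ∑ j ∈ Finset.range i, 2 ^ j = 2 ^ i - 1 := by
        simpa using Nat.geomSum_eq (le_refl 2) i
      have heq : M = Finset.range i := by
        by_contra hM'
        obtain ⟨a, ha, haM⟩ := Finset.exists_of_ssubset (hsub.ssubset_of_ne hM')
        have := Finset.sum_lt_sum_of_subset (f := fun j => 2 ^ j) hsub ha haM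
          (by positivity) (fun j _ _ => Nat.zero_le _)
        omega
      simp [heq]
    · push Not at hlt
      obtain ⟨j, hj, hij⟩ := hlt
      obtain ⟨T, rfl⟩ := Multiset.exists_cons_of_mem hj
      obtain ⟨d, rfl⟩ := Nat.exists_eq_add_of_le hij
      have hpow : 2 ^ (i + d) = 2 ^ d + (2 ^ i - 1) * 2 ^ d := by
        have := Nat.one_le_two_pow (n := i)
        rw [pow_add, Nat.sub_mul, one_mul]
        have := Nat.mul_le_mul_right (2 ^ d) this
        omega
      have hlt : 2 ^ d < 2 ^ (i + d) := Nat.pow_lt_pow_right (by norm_num) (by omega)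
      simp only [Multiset.map_cons, Multiset.sum_cons, Multiset.card_cons] at h hdvd
      have := ih _ (by
        simp only [Multiset.map_cons, Multiset.sum_cons, Multiset.card_cons]
        omega) (d ::ₘ T) (by simp) (by
        rw [hpow, add_right_comm] at hdvd
        simpa using (Nat.dvd_add_left (dvd_mul_right _ _)).1 hdvd) rfl
      simpa using this
  · rw [Multiset.nodup_iff_le] at hnd
    push Not at hnd
    obtain ⟨a, ha⟩ := hnd
    obtain ⟨T, rfl⟩ := Multiset.le_iff_exists_add.1 ha
    have hsum : (((a + 1) ::ₘ T).map (2 ^ ·)).sum = ((a ::ₘ a ::ₘ T).map (2 ^ ·)).sum := by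
      simp only [Multiset.map_cons, Multiset.sum_cons, pow_succ]
      ring
    have hcons : (a ::ₘ a ::ₘ 0) + T = a ::ₘ a ::ₘ T := by simp
    rw [hcons] at h hdvd ⊢
    have := ih _ (by rw [hsum, ← h]; simp) ((a + 1) ::ₘ T) (by simp) (by rwa [hsum]) rfl
    simp only [Multiset.card_cons] at this ⊢
    omega

/-- If `k = 2^i - 1` is a Mersenne prime with `i ≥ 2`, then `k ∈ 𝒞_i` but
`k ∉ 𝒞_(i-1)`. -/
theorem mersenne_prime_mem_C
    (i k : ℕ) (hi : 2 ≤ i) (hk : k = 2 ^ i - 1) (hp : Nat.Prime k) :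
    memC i k ∧ ¬ memC (i - 1) k := by
  have h4 : 2 ^ 2 ≤ 2 ^ i := Nat.pow_le_pow_right (by norm_num) hi
  have hodd : Odd k := by
    rw [hk]
    exact Nat.Even.sub_odd (by omega) (by simp [Nat.even_pow]; omega) odd_one
  have : Fact k.Prime := ⟨hp⟩
  have hfermat : (2 : ZMod k) ^ k = 2 := ZMod.pow_card _
  have hmers : (2 : ZMod k) ^ i = 1 := by
    have : ((2 ^ i : ℕ) : ZMod k) = ((k + 1 : ℕ) : ZMod k) := by congr 1; omega
    simpa using this
  refine ⟨⟨hodd, hp.pos, insert (i + 1) (Finset.Ico 1 i), ?_, ?_, ?_⟩, ?_⟩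
  · rw [Finset.card_insert_of_notMem (by simp), Nat.card_Ico]
    omega
  · intro j hj
    simp only [Finset.mem_insert, Finset.mem_Ico] at hj
    omega
  · rw [← ZMod.natCast_eq_natCast_iff, Finset.sum_insert (by simp),
      Nat.cast_sub Nat.one_le_two_pow]
    have hgeom : (∑ j ∈ Finset.Ico 1 i, (2 : ZMod k) ^ j) = 2 ^ i - 2 := by
      have h1 := geom_sum_mul (2 : ZMod k) i
      rw [Finset.range_eq_Ico, Finset.sum_eq_sum_Ico_succ_bot (by omega)] at h1
      linear_combination h1
    push_cast
    rw [hgeom, pow_add, pow_add, hfermat, hmers]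
    ring
  · rintro ⟨-, -, S, hcard, -, hS⟩
    rw [← ZMod.natCast_eq_natCast_iff, Nat.cast_sub Nat.one_le_two_pow] at hS
    have hzero : (2 : ZMod k) ^ (k + (i - 1)) = 1 := by
      rw [pow_add, hfermat, ← pow_succ', Nat.sub_add_cancel (by omega), hmers]
    have hdvd : k ∣ ∑ j ∈ S, 2 ^ j := by
      rw [← ZMod.natCast_eq_zero_iff, ← hS]
      push_cast
      rw [hzero, sub_self]
    rw [hk] at hdvd
    have hne : S.val ≠ 0 := by
      intro h0
      have : S.card = 0 := by simp [Finset.card_def, h0]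
      omega
    have : i ≤ S.card := le_card_of_two_pow_sub_one_dvd_sum i (by omega) S.val hne hdvd
    omega
end

section
/- Let 𝒞 = {n ≥ 1 : 2^{n+1} − 1 ≡ 2^j (mod n) for some positive integer j}. There exists an absolute constant C > 0 such that for all real x > e^e, the number of elements of 𝒞 not exceeding x is at most C·x/(log log x)^{1/7}. In particular, 𝒞 has asymptotic density zero. -/
open Filter

/-- The set `𝒞 = {n ≥ 1 : 2^(n+1) - 1 ≡ 2^j (mod n) for some positive integer j}`. -/
def setC : Set ℕ :=
  {n : ℕ | 1 ≤ n ∧ ∃ j : ℕ, 0 < j ∧ 2 ^ (n + 1) - 1 ≡ 2 ^ j [MOD n]}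

section Stepanov

open Polynomial

variable {F : Type*} [Field F]

/-- A nonzero polynomial of degree less than the characteristic with `r` nonzero coefficients
vanishes at `1` to order less than `r`. -/
theorem lt_card_support_of_X_sub_one_pow_dvd (q : ℕ) [CharP F q] (d : ℕ) :
    ∀ (f : F[X]) (s : ℕ), f ≠ 0 → f.natDegree ≤ d → f.natDegree < q → (X - 1) ^ s ∣ f →
      s < f.support.card := by
  induction d using Nat.strong_induction_on with
  | _ d ih =>
  intro f s hf hd hq hs
  have hcop : IsCoprime ((X - 1 : F[X]) ^ s) X := by
    refine IsCoprime.pow_left ⟨-1, 1, by ring⟩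
  by_cases h0 : f.coeff 0 = 0
  · obtain ⟨g, rfl⟩ := X_dvd_iff.mpr h0
    have hg : g ≠ 0 := right_ne_zero_of_mul hf
    have hdeg : (X * g).natDegree = g.natDegree + 1 := by
      rw [natDegree_X_mul hg]
    have hcard : g.support.card ≤ (X * g).support.card :=
      Finset.card_le_card_of_injOn (fun n => n + 1) (fun n hn => by simpa using hn)
        (fun a _ b _ h => by simpa using h)
    exact (ih g.natDegree (by omega) g s hg le_rfl (by omega)
      (hcop.dvd_of_dvd_mul_left hs)).trans_le hcard
  · rcases s with _ | s
    · simpa [Finset.card_pos] using hf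
    · have hder : derivative f ≠ 0 := by
        intro hz
        have hc : ∀ n, f.coeff (n + 1) = 0 := by
          intro n
          by_contra hne
          have h1 := congrArg (fun g => g.coeff n) hz
          simp only [coeff_derivative, coeff_zero] at h1
          rcases mul_eq_zero.mp h1 with h | h
          · exact hne h
          · have h2 : ((n + 1 : ℕ) : F) = 0 := by exact_mod_cast h
            rw [CharP.cast_eq_zero_iff F q] at h2
            have h3 := Nat.le_of_dvd (by omega) h2
            have h4 := le_natDegree_of_ne_zero hne
            omega
        have hfC : f = C (f.coeff 0) := by
          ext n
          rcases n with _ | n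
          · simp
          · simp [hc n]
        have h1 : (X - 1 : F[X]) ∣ f := (dvd_pow_self _ (by omega)).trans hs
        have h2 : f.eval 1 = 0 := by
          obtain ⟨g, rfl⟩ := h1
          simp
        rw [hfC] at h2
        simp at h2
        exact h0 h2
      have hdeg : f.natDegree ≠ 0 := by
        intro h
        exact hder (derivative_of_natDegree_zero h)
      have hlt := natDegree_derivative_lt hdeg
      have hdvd : (X - 1 : F[X]) ^ s ∣ derivative f := by
        simpa using pow_sub_one_dvd_derivative_of_pow_dvd hs
      have h1 := ih _ (lt_of_lt_of_le hlt hd) (derivative f) s hder le_rfl (by omega) hdvd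
      have h2 : (derivative f).support.card ≤ (f.support.erase 0).card := by
        refine Finset.card_le_card_of_injOn (fun n => n + 1) ?_ (fun a _ b _ h => by simpa using h)
        intro n hn
        have hn' : (derivative f).coeff n ≠ 0 := by simpa using hn
        rw [coeff_derivative] at hn'
        simpa using left_ne_zero_of_mul hn'
      have h3 : (0 : ℕ) ∈ f.support := by simpa using h0
      rw [Finset.card_erase_of_mem h3] at h2
      omega

/-- The operator sending `P` to `(X(X-1))ᵏ W⁻¹ (d/dX)ᵏ (P W)`, where `W = X^β (X-1)^γ`. -/
noncomputable def twistedDerivative (β γ : ℕ) : ℕ → F[X] →ₗ[F] F[X]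
  | 0 => LinearMap.id
  | k + 1 => LinearMap.mulLeft F (X * (X - 1)) ∘ₗ derivative ∘ₗ twistedDerivative β γ k +
      LinearMap.mulLeft F (C (β : F) * (X - 1) + C (γ : F) * X - C (k : F) * (2 * X - 1)) ∘ₗ
        twistedDerivative β γ k

theorem natDegree_twistedDerivative_le (β γ k : ℕ) (P : F[X]) :
    (twistedDerivative β γ k P).natDegree ≤ P.natDegree + k := by
  induction k with
  | zero => simp [twistedDerivative]
  | succ k ih =>
    simp only [twistedDerivative, LinearMap.add_apply, LinearMap.comp_apply,
      LinearMap.mulLeft_apply]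
    generalize hQ : twistedDerivative β γ k P = Q at ih ⊢
    refine natDegree_add_le_of_degree_le ?_ ?_
    · by_cases h : Q.natDegree = 0
      · simp [derivative_of_natDegree_zero h]
      · have h1 := natDegree_derivative_lt h
        refine natDegree_mul_le.trans ?_
        have h2 : (X * (X - 1) : F[X]).natDegree ≤ 2 := by compute_degree
        omega
    · refine natDegree_mul_le.trans ?_
      have h2 : (C (β : F) * (X - 1) + C (γ : F) * X - C (k : F) * (2 * X - 1) : F[X]).natDegree
          ≤ 1 := by compute_degree
      omega

theorem mul_derivative_pow (g : F[X]) (k : ℕ) :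
    g * derivative (g ^ k) = C (k : F) * derivative g * g ^ k := by
  rcases k with _ | k
  · simp
  · rw [derivative_pow, Nat.add_sub_cancel]
    ring

theorem X_mul_X_sub_one_mul_derivative (β γ : ℕ) :
    (X * (X - 1) : F[X]) * derivative (X ^ β * (X - 1) ^ γ) =
      (C (β : F) * (X - 1) + C (γ : F) * X) * (X ^ β * (X - 1) ^ γ) := by
  have h1 := mul_derivative_pow (X : F[X]) β
  have h2 := mul_derivative_pow (X - 1 : F[X]) γ
  simp only [derivative_X, derivative_sub, derivative_one, sub_zero, mul_one] at h1 h2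
  rw [derivative_mul]
  linear_combination (X - 1) * (X - 1) ^ γ * h1 + X * X ^ β * h2

theorem pow_mul_iterate_derivative (β γ k : ℕ) (P : F[X]) :
    (X * (X - 1)) ^ k * derivative^[k] (P * (X ^ β * (X - 1) ^ γ)) =
      twistedDerivative β γ k P * (X ^ β * (X - 1) ^ γ) := by
  induction k with
  | zero => simp [twistedDerivative]
  | succ k ih =>
    simp only [twistedDerivative, LinearMap.add_apply, LinearMap.comp_apply,
      LinearMap.mulLeft_apply, Function.iterate_succ_apply']
    generalize twistedDerivative β γ k P = Q at ih ⊢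
    generalize derivative^[k] (P * (X ^ β * (X - 1) ^ γ)) = g at ih ⊢
    have hW := X_mul_X_sub_one_mul_derivative (F := F) β γ
    generalize (X ^ β * (X - 1) ^ γ : F[X]) = W at ih hW ⊢
    have h1 := congrArg derivative ih
    rw [derivative_mul, derivative_mul] at h1
    have h2 := mul_derivative_pow (X * (X - 1) : F[X]) k
    simp only [derivative_mul, derivative_X, derivative_sub, derivative_one, sub_zero,
      one_mul, mul_one] at h2
    linear_combination (X * (X - 1)) * h1 - g * h2 + Q * hW - C (k : F) * (2 * X - 1) * ih

/-- The polynomial of degree less than `A` with the given coefficients. -/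
noncomputable def polyOfCoeffs (A : ℕ) : (Fin A → F) →ₗ[F] F[X] :=
  (degreeLT F A).subtype ∘ₗ (degreeLTEquiv F A).symm.toLinearMap

theorem degree_polyOfCoeffs_lt (A : ℕ) (v : Fin A → F) : (polyOfCoeffs A v).degree < A :=
  mem_degreeLT.mp ((degreeLTEquiv F A).symm v).2

theorem polyOfCoeffs_eq_zero_iff (A : ℕ) (v : Fin A → F) : polyOfCoeffs A v = 0 ↔ v = 0 := by
  simp [polyOfCoeffs]

theorem natDegree_polyOfCoeffs_lt {A : ℕ} (hA : 0 < A) (v : Fin A → F) :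
    (polyOfCoeffs A v).natDegree < A := by
  by_cases h : polyOfCoeffs A v = 0
  · simpa [h] using hA
  · exact (natDegree_lt_iff_degree_lt h).mpr (degree_polyOfCoeffs_lt A v)

/-- The auxiliary polynomial of Stepanov's method. -/
noncomputable def stepanovPoly (t : ℕ) {A B : ℕ} (v : Fin B × Fin B → Fin A → F) : F[X] :=
  ∑ i : Fin B × Fin B, polyOfCoeffs A (v i) * (X ^ (t * i.1) * (X - 1) ^ (t * i.2))

theorem exists_coeffs_twistedDerivative_eq_zero (t : ℕ) {A B M : ℕ}
    (h : M * (A + M) < B * B * A) :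
    ∃ v : Fin B × Fin B → Fin A → F, v ≠ 0 ∧ ∀ k < M,
      ∑ i : Fin B × Fin B, twistedDerivative (t * i.1) (t * i.2) k (polyOfCoeffs A (v i)) = 0 := by
  have hA : 0 < A := by
    rcases A with _ | A
    · simp at h
    · omega
  let T : (Fin B × Fin B → Fin A → F) →ₗ[F] (Fin M → Fin (A + M) → F) :=
    LinearMap.pi fun k => LinearMap.pi fun j => ∑ i : Fin B × Fin B,
      lcoeff F j ∘ₗ twistedDerivative (t * i.1) (t * i.2) k ∘ₗ polyOfCoeffs A ∘ₗ LinearMap.proj i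
  have hT : LinearMap.ker T ≠ ⊥ := by
    apply LinearMap.ker_ne_bot_of_finrank_lt
    simpa [Module.finrank_pi_fintype, mul_assoc] using h
  obtain ⟨v, hv, hv0⟩ := Submodule.exists_mem_ne_zero_of_ne_bot hT
  refine ⟨v, hv0, fun k hk => ?_⟩
  ext j
  by_cases hj : j < A + M
  · have := congrFun (congrFun (LinearMap.mem_ker.mp hv) ⟨k, hk⟩) ⟨j, hj⟩
    simpa [T, finsetSum_coeff] using this
  · rw [finsetSum_coeff, coeff_zero]
    refine Finset.sum_eq_zero fun i _ => coeff_eq_zero_of_natDegree_lt ?_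
    have h1 := natDegree_twistedDerivative_le (t * i.1) (t * i.2) k (polyOfCoeffs A (v i))
    have h2 := natDegree_polyOfCoeffs_lt hA (v i)
    omega

theorem stepanovPoly_ne_zero (q : ℕ) [CharP F q] {t A B : ℕ} (hA : 0 < A) (hAt : A * B ≤ t)
    (hB : 0 < B) (htq : t * B ≤ q) {v : Fin B × Fin B → Fin A → F} (hv : v ≠ 0) :
    stepanovPoly t v ≠ 0 := by
  have hAlet : A ≤ t := (Nat.le_mul_of_pos_right A hB).trans hAt
  intro hΨ
  let f : ℕ → F[X] := fun c => if hc : c < B then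
    ∑ b : Fin B, polyOfCoeffs A (v (b, ⟨c, hc⟩)) * X ^ (t * b) else 0
  have hsum : ∑ c ∈ Finset.range B, f c * (X - 1) ^ (t * c) = 0 := by
    rw [← hΨ, stepanovPoly, Fintype.sum_prod_type_right, Finset.sum_range]
    refine Finset.sum_congr rfl fun c _ => ?_
    simp only [f, c.2, dif_pos, Finset.sum_mul, mul_assoc]
  have hcoeff : ∀ (c b : Fin B) (a : ℕ), a < A →
      (f c).coeff (a + t * b) = (polyOfCoeffs A (v (b, c))).coeff a := by
    intro c b a ha
    simp only [f, c.2, dif_pos, finsetSum_coeff, coeff_mul_X_pow', Fin.eta]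
    rw [Finset.sum_eq_single b]
    · simp
    · intro b' _ hb'
      split_ifs with hle
      · apply coeff_eq_zero_of_natDegree_lt
        have h2 := natDegree_polyOfCoeffs_lt hA (v (b', c))
        have hlt : (b' : ℕ) < b := by
          by_contra hcon
          have : (b : ℕ) < b' := lt_of_le_of_ne (not_lt.mp hcon) (fun h => hb' (Fin.ext h.symm))
          have := Nat.mul_le_mul_left t (Nat.succ_le_of_lt this)
          rw [Nat.mul_succ] at this
          omega
        have := Nat.mul_le_mul_left t (Nat.succ_le_of_lt hlt)
        rw [Nat.mul_succ] at this
        show _ < a + t * b - t * b'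
        omega
      · rfl
    · simp
  have hex : ∃ c, f c ≠ 0 := by
    by_contra! hcon
    apply hv
    funext i
    rw [Pi.zero_apply, ← polyOfCoeffs_eq_zero_iff]
    ext a
    by_cases ha : a < A
    · rw [← hcoeff i.2 i.1 a ha, hcon]
      simp
    · exact coeff_eq_zero_of_natDegree_lt
        ((natDegree_polyOfCoeffs_lt hA (v i)).trans_le (not_lt.mp ha))
  classical
  let c₀ := Nat.find hex
  have hc₀ : f c₀ ≠ 0 := Nat.find_spec hex
  have hc₀B : c₀ < B := by
    by_contra h
    exact hc₀ (by simp [f, h])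
  have hdvd : (X - 1 : F[X]) ^ t ∣ f c₀ := by
    have hd : (X - 1 : F[X]) ^ (t * c₀ + t) ∣ f c₀ * (X - 1) ^ (t * c₀) := by
      rw [← Finset.add_sum_erase _ _ (Finset.mem_range.mpr hc₀B)] at hsum
      rw [eq_neg_of_add_eq_zero_left hsum, dvd_neg]
      refine Finset.dvd_sum fun c hc => ?_
      rcases lt_or_ge c c₀ with hlt | hge
      · have : f c = 0 := by
          by_contra h
          exact Nat.find_min hex hlt h
        simp [this]
      · have hne := Finset.ne_of_mem_erase hc
        refine Dvd.dvd.mul_left (pow_dvd_pow _ ?_) _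
        have := Nat.mul_le_mul_left t (Nat.succ_le_of_lt (lt_of_le_of_ne hge hne.symm))
        rwa [Nat.mul_succ] at this
    rw [pow_add, mul_comm] at hd
    have hX : (X - 1 : F[X]) ≠ 0 := by simpa using X_sub_C_ne_zero (1 : F)
    exact (mul_dvd_mul_iff_right (pow_ne_zero _ hX)).mp hd
  have hsupp : ∀ n, (f c₀).coeff n ≠ 0 → ∃ a < A, ∃ b < B, n = a + t * b := by
    intro n hn
    simp only [f, hc₀B, dif_pos, finsetSum_coeff, coeff_mul_X_pow'] at hn
    obtain ⟨b, _, hb⟩ := Finset.exists_ne_zero_of_sum_ne_zero hn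
    split_ifs at hb with hle
    · have h1 := le_natDegree_of_ne_zero hb
      have h2 := natDegree_polyOfCoeffs_lt hA (v (b, ⟨c₀, hc₀B⟩))
      exact ⟨n - t * b, by omega, b, b.2, by omega⟩
    · exact absurd rfl hb
  have hcard : (f c₀).support.card ≤ A * B := by
    have : (f c₀).support ⊆
        (Finset.range A ×ˢ Finset.range B).image (fun x => x.1 + t * x.2) := by
      intro n hn
      obtain ⟨a, ha, b, hb, rfl⟩ := hsupp n (mem_support_iff.mp hn)
      exact Finset.mem_image.mpr ⟨(a, b), by simp [ha, hb], rfl⟩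
    refine (Finset.card_le_card this).trans (Finset.card_image_le.trans ?_)
    simp
  have hdeg : (f c₀).natDegree < q := by
    obtain ⟨a, ha, b, hb, hab⟩ := hsupp (f c₀).natDegree
      (by simpa using hc₀)
    have := Nat.mul_le_mul_left t (Nat.succ_le_of_lt hb)
    rw [Nat.mul_succ] at this
    omega
  have := lt_card_support_of_X_sub_one_pow_dvd q _ (f c₀) t hc₀ le_rfl hdeg hdvd
  omega

/-- Stepanov's method: consecutive elements of a small multiplicative subgroup are rare. -/
theorem card_mul_le_of_pow_eq_one {q : ℕ} [Fact q.Prime] {t m : ℕ} (hm : 0 < m)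
    (hmt : 2 * m ^ 3 ≤ t) (htq : 2 * m * t ≤ q) (S : Finset (ZMod q))
    (hS : ∀ x ∈ S, x ^ t = 1 ∧ (x - 1) ^ t = 1) : S.card * m ≤ 5 * t := by
  have hm2 : 0 < m ^ 2 := by positivity
  have htpos : 0 < t := lt_of_lt_of_le (by positivity) hmt
  obtain ⟨v, hv0, hv⟩ := exists_coeffs_twistedDerivative_eq_zero (F := ZMod q) t (A := m ^ 2)
    (B := 2 * m) (M := m ^ 2) (by nlinarith [pow_pos hm 4])
  have hne : stepanovPoly t v ≠ 0 := stepanovPoly_ne_zero q hm2 (by linarith [pow_succ m 2])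
    (by omega) (by linarith) hv0
  have hmq : m ^ 2 < q := by nlinarith [pow_succ m 2]
  have hroot : ∀ x ∈ S, (X - C x) ^ (m ^ 2) ∣ stepanovPoly t v := by
    intro x hx
    obtain ⟨hx1, hx2⟩ := hS x hx
    have hx0 : x ≠ 0 := by
      rintro rfl
      simp [htpos.ne'] at hx1
    have hx0' : x - 1 ≠ 0 := by
      intro h
      simp [h, htpos.ne'] at hx2
    have hlt : m ^ 2 - 1 < (stepanovPoly t v).rootMultiplicity x := by
      apply lt_rootMultiplicity_of_isRoot_iterate_derivative_of_mem_nonZeroDivisors' hne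
      · intro k hk
        have hk' : k < m ^ 2 := by omega
        have h1 : (X * (X - 1)) ^ k * derivative^[k] (stepanovPoly t v) =
            ∑ i : Fin (2 * m) × Fin (2 * m),
              twistedDerivative (t * i.1) (t * i.2) k (polyOfCoeffs (m ^ 2) (v i)) *
                (X ^ (t * i.1) * (X - 1) ^ (t * i.2)) := by
          rw [stepanovPoly, iterate_derivative_sum, Finset.mul_sum]
          exact Finset.sum_congr rfl fun i _ => pow_mul_iterate_derivative _ _ _ _
        have h2 := congrArg (eval x) h1
        have h3 := congrArg (eval x) (hv k hk')
        simp only [eval_mul, eval_pow, eval_X, eval_sub, eval_one, eval_finsetSum, pow_mul,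
          hx1, hx2, one_pow, mul_one, eval_zero] at h2 h3
        rw [h3] at h2
        exact (mul_eq_zero.mp h2).resolve_left (pow_ne_zero _ (mul_ne_zero hx0 hx0'))
      · intro k hk hk0
        apply mem_nonZeroDivisors_of_ne_zero
        rw [Ne, ZMod.natCast_eq_zero_iff]
        intro hd
        have := Nat.le_of_dvd (by omega) hd
        omega
    exact (le_rootMultiplicity_iff hne).mp (by omega)
  have hprod : ∏ x ∈ S, (X - C x) ^ (m ^ 2) ∣ stepanovPoly t v := by
    refine Finset.prod_dvd_of_coprime (fun x _ y _ hxy => ?_) hroot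
    exact (pairwise_coprime_X_sub_C Function.injective_id hxy).pow
  have hdeg1 : (∏ x ∈ S, (X - C x) ^ (m ^ 2) : (ZMod q)[X]).natDegree = S.card * m ^ 2 := by
    rw [natDegree_prod_of_monic _ _ (fun x _ => (monic_X_sub_C x).pow _)]
    simp [natDegree_pow]
  have hdeg2 : (stepanovPoly t v).natDegree ≤ m ^ 2 + (t * (2 * m) + t * (2 * m)) := by
    refine natDegree_sum_le_of_forall_le _ _ fun i _ => ?_
    refine natDegree_mul_le.trans (add_le_add (natDegree_polyOfCoeffs_lt hm2 _).le ?_)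
    refine natDegree_mul_le.trans (add_le_add ?_ ?_)
    · rw [natDegree_X_pow]
      exact Nat.mul_le_mul_left t i.1.2.le
    · refine natDegree_pow_le.trans ?_
      have : (X - 1 : (ZMod q)[X]).natDegree = 1 := by simpa using natDegree_X_sub_C (1 : ZMod q)
      rw [this, mul_one]
      exact Nat.mul_le_mul_left t i.2.2.le
  have hle := natDegree_le_of_dvd hprod hne
  rw [hdeg1] at hle
  have h5 : S.card * m * m ≤ (5 * t) * m := by nlinarith [pow_pos hm 2, pow_pos hm 3]
  exact Nat.le_of_mul_le_mul_right h5 hm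

end Stepanov

section PeriodicSums

open Finset

theorem sum_range_mul_eq_sum_sum {M : Type*} [AddCommMonoid M] (f : ℕ → M) (u t : ℕ) :
    ∑ k ∈ range (u * t), f k = ∑ a ∈ range u, ∑ j ∈ range t, f (a + u * j) := by
  rw [sum_comm]
  induction t with
  | zero => simp
  | succ t ih =>
    rw [Nat.mul_succ, sum_range_add, ih, sum_range_succ]
    simp only [add_comm]

theorem Function.Periodic.sum_range_mul {f : ℕ → ℝ} {T : ℕ} (hf : Function.Periodic f T) (k : ℕ) :
    ∑ j ∈ range (T * k), f j = k * ∑ j ∈ range T, f j := by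
  rw [sum_range_mul_eq_sum_sum, mul_sum]
  refine sum_congr rfl fun a _ => ?_
  rw [sum_congr rfl (g := fun _ => f a)]
  · simp
  · intro j _
    have := hf.nat_mul j a
    simpa [mul_comm] using this

theorem Function.Periodic.abs_sum_range_le {f : ℕ → ℝ} {T : ℕ} (hT : 0 < T)
    (hf : Function.Periodic f T) (hf1 : ∀ n, |f n| ≤ 1) {E : ℝ}
    (hE : |∑ j ∈ range T, f j| ≤ E * T) (K : ℕ) :
    |∑ k ∈ range K, f k| ≤ K * E + T := by
  have hT' : (0 : ℝ) < T := by exact_mod_cast hT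
  have hE0 : 0 ≤ E := by
    by_contra! h
    have := (abs_nonneg _).trans hE
    nlinarith
  have hK : K = T * (K / T) + K % T := (Nat.div_add_mod K T).symm
  have h1 : ∑ k ∈ range K, f k =
      (K / T : ℕ) * ∑ j ∈ range T, f j + ∑ k ∈ range (K % T), f (T * (K / T) + k) := by
    conv_lhs => rw [hK, sum_range_add, hf.sum_range_mul]
  have h2 : |∑ k ∈ range (K % T), f (T * (K / T) + k)| ≤ T := by
    refine (abs_sum_le_sum_abs _ _).trans ((sum_le_sum fun k _ => hf1 _).trans ?_)
    simpa using (Nat.mod_lt K hT).le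
  have h3 : ((K / T : ℕ) : ℝ) * T ≤ K := by
    exact_mod_cast Nat.div_mul_le_self K T
  rw [h1]
  refine (abs_add_le _ _).trans (add_le_add ?_ h2)
  rw [abs_mul, Nat.abs_cast]
  calc ((K / T : ℕ) : ℝ) * |∑ j ∈ range T, f j| ≤ ((K / T : ℕ) : ℝ) * (E * T) := by gcongr
    _ = (((K / T : ℕ) : ℝ) * T) * E := by ring
    _ ≤ K * E := by gcongr

end PeriodicSums

section QuadraticCharSums

open Finset

variable {q : ℕ} [Fact q.Prime]

theorem quadraticChar_abs_le_one (a : ZMod q) : |quadraticChar (ZMod q) a| ≤ 1 := by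
  by_cases h : a = 0
  · simp [h]
  · rcases quadraticChar_dichotomy h with h | h <;> simp [h]

theorem sum_quadraticChar_mul_le_one (hq : q ≠ 2) {u v : ZMod q} (hu : u ≠ 0) (hv : v ≠ 0)
    (huv : u ≠ v) :
    ∑ c : ZMod q, quadraticChar (ZMod q) ((c * u - 1) * (c * v - 1)) ≤ 1 := by
  set χ := quadraticChar (ZMod q)
  have hχ : χ ≠ 1 := quadraticChar_ne_one (by rwa [ZMod.ringChar_zmod_n])
  have hδ : v⁻¹ - u⁻¹ ≠ 0 := by
    rw [sub_ne_zero]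
    exact fun h => huv (inv_injective h).symm
  have hbij : Function.Bijective (fun s : ZMod q => u⁻¹ + (v⁻¹ - u⁻¹) * s) := by
    refine Finite.injective_iff_bijective.mp fun a b hab => ?_
    exact mul_left_cancel₀ hδ (add_left_cancel hab)
  have h1 : ∑ c : ZMod q, χ ((c * u - 1) * (c * v - 1)) =
      χ (-(u * v)) * ∑ s : ZMod q, χ s * χ (1 - s) := by
    rw [← hbij.sum_comp, mul_sum]
    refine sum_congr rfl fun s _ => ?_
    have : ((u⁻¹ + (v⁻¹ - u⁻¹) * s) * u - 1) * ((u⁻¹ + (v⁻¹ - u⁻¹) * s) * v - 1) =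
        -(u * v) * (v⁻¹ - u⁻¹) ^ 2 * (s * (1 - s)) := by
      field_simp
      ring
    rw [this, map_mul, map_mul, map_mul, quadraticChar_sq_one' hδ, mul_one]
  have h2 : ∑ s : ZMod q, χ s * χ (1 - s) = -χ (-1) := by
    have h := jacobiSum_nontrivial_inv hχ
    have hinv : χ⁻¹ = χ := (quadraticChar_isQuadratic (ZMod q)).inv
    rw [hinv] at h
    exact h
  rw [h1, h2]
  have h3 := quadraticChar_abs_le_one (-(u * v))
  have h4 := quadraticChar_abs_le_one (-1 : ZMod q)
  calc χ (-(u * v)) * -χ (-1) ≤ |χ (-(u * v)) * -χ (-1)| := le_abs_self _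
    _ = |χ (-(u * v))| * |χ (-1)| := by rw [abs_mul, abs_neg]
    _ ≤ 1 * 1 := by gcongr
    _ = 1 := one_mul 1

theorem sq_sum_quadraticChar_geom_le (hq : q ≠ 2) {c g : ZMod q} (hc : c ≠ 0) (hg : g ≠ 0) :
    (∑ j ∈ range (orderOf g), quadraticChar (ZMod q) (c * g ^ j - 1)) ^ 2 ≤ q := by
  set χ := quadraticChar (ZMod q)
  set e := orderOf g with he
  have hfin : IsOfFinOrder g := by
    rw [isOfFinOrder_iff_pow_eq_one]
    exact ⟨q - 1, Nat.sub_pos_of_lt (Fact.out : q.Prime).one_lt, ZMod.pow_card_sub_one_eq_one hg⟩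
  have he0 : 0 < e := hfin.orderOf_pos
  let s : ZMod q → ℤ := fun c => ∑ j ∈ range e, χ (c * g ^ j - 1)
  have hs : ∀ c, s (c * g) = s c := by
    intro c
    have h1 := sum_range_succ (fun j => χ (c * g ^ j - 1)) e
    have h2 := sum_range_succ' (fun j => χ (c * g ^ j - 1)) e
    have h3 : g ^ e = 1 := pow_orderOf_eq_one g
    simp only [h3, pow_zero] at h1 h2
    have h4 : s (c * g) = ∑ j ∈ range e, χ (c * g ^ (j + 1) - 1) :=
      sum_congr rfl fun j _ => by rw [pow_succ']; ring_nf
    rw [h4]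
    show _ = ∑ j ∈ range e, χ (c * g ^ j - 1)
    linarith
  have hs' : ∀ c j, s (c * g ^ j) = s c := by
    intro c j
    induction j with
    | zero => simp
    | succ j ih => rw [pow_succ, ← mul_assoc, hs, ih]
  have hinj : Set.InjOn (fun j => c * g ^ j) (range e : Set ℕ) := by
    intro i hi j hj hij
    exact hfin.pow_inj_mod.mp (mul_left_cancel₀ hc hij) |> fun h => by
      simpa [Nat.mod_eq_of_lt (mem_range.mp (mem_coe.mp hi)),
        Nat.mod_eq_of_lt (mem_range.mp (mem_coe.mp hj)), ← he] using h
  have hlow : (e : ℤ) * s c ^ 2 + s 0 ^ 2 ≤ ∑ x : ZMod q, s x ^ 2 := by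
    have h1 : ∑ x ∈ insert 0 ((range e).image fun j => c * g ^ j), s x ^ 2 ≤
        ∑ x : ZMod q, s x ^ 2 :=
      sum_le_sum_of_subset_of_nonneg (subset_univ _) fun x _ _ => sq_nonneg _
    rw [sum_insert, sum_image hinj] at h1
    · simp only [hs', sum_const, card_range, nsmul_eq_mul] at h1
      linarith
    · simp [hc, hg]
  have hs0 : s 0 ^ 2 = (e : ℤ) ^ 2 := by
    have : ∀ j, χ (0 * g ^ j - 1) = χ (-1) := fun j => by simp
    simp only [s, this, sum_const, card_range, nsmul_eq_mul, mul_pow]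
    rw [quadraticChar_sq_one (by simp), mul_one]
  have hup : ∑ x : ZMod q, s x ^ 2 ≤ (e : ℤ) * q + (e : ℤ) ^ 2 := by
    have h1 : ∑ x : ZMod q, s x ^ 2 = ∑ i ∈ range e, ∑ j ∈ range e,
        ∑ x : ZMod q, χ ((x * g ^ i - 1) * (x * g ^ j - 1)) := by
      simp only [s, sq, sum_mul_sum, map_mul]
      rw [sum_comm]
      exact sum_congr rfl fun i _ => sum_comm
    have h2 : ∀ i ∈ range e, ∑ j ∈ range e,
        ∑ x : ZMod q, χ ((x * g ^ i - 1) * (x * g ^ j - 1)) ≤ q + e := by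
      intro i hi
      rw [← add_sum_erase _ _ hi]
      refine add_le_add ?_ ?_
      · refine (sum_le_card_nsmul univ _ 1 fun x _ => ?_).trans (by simp)
        exact (abs_le.mp (quadraticChar_abs_le_one _)).2
      · refine (sum_le_card_nsmul _ _ 1 fun j hj => ?_).trans ?_
        · obtain ⟨hji, hj⟩ := mem_erase.mp hj
          refine sum_quadraticChar_mul_le_one hq (pow_ne_zero _ hg) (pow_ne_zero _ hg) fun h => ?_
          apply hji
          have := hfin.pow_inj_mod.mp h
          simpa [Nat.mod_eq_of_lt (mem_range.mp hi), Nat.mod_eq_of_lt (mem_range.mp hj), ← he,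
            eq_comm] using this
        · have h3 : ((range e).erase i).card ≤ e := card_erase_le.trans (card_range e).le
          simpa using h3
    rw [h1]
    refine (sum_le_card_nsmul _ _ _ h2).trans (le_of_eq ?_)
    simp only [card_range, nsmul_eq_mul]
    ring
  have he' : (0 : ℤ) < e := by exact_mod_cast he0
  have : (e : ℤ) * s c ^ 2 ≤ e * q := by linarith
  exact le_of_mul_le_mul_left this he'

end QuadraticCharSums

section Weights

open Finset

theorem lt_two_pow_orderOf_two {q : ℕ} [hq : Fact q.Prime] (hq2 : q ≠ 2) :
    q < 2 ^ orderOf (2 : ZMod q) := by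
  have h2 : (2 : ZMod q) ≠ 0 := by
    intro h
    have : ((2 : ℕ) : ZMod q) = 0 := by exact_mod_cast h
    rw [ZMod.natCast_eq_zero_iff] at this
    exact hq2 ((Nat.prime_dvd_prime_iff_eq hq.out Nat.prime_two).mp this)
  have hpos : 0 < orderOf (2 : ZMod q) := orderOf_pos_iff.mpr
    (isOfFinOrder_iff_pow_eq_one.mpr ⟨q - 1, Nat.sub_pos_of_lt hq.out.one_lt,
      ZMod.pow_card_sub_one_eq_one h2⟩)
  have h : ((2 ^ orderOf (2 : ZMod q) : ℕ) : ZMod q) = (1 : ℕ) := by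
    push_cast
    exact pow_orderOf_eq_one _
  have h1 : 1 < 2 ^ orderOf (2 : ZMod q) := Nat.one_lt_two_pow hpos.ne'
  have h3 := (Nat.modEq_iff_dvd' h1.le).mp ((ZMod.natCast_eq_natCast_iff _ _ _).mp h).symm
  have h4 := Nat.le_of_dvd (by omega) h3
  omega

theorem abs_sum_mul_quadraticChar_le {q : ℕ} [hq : Fact q.Prime] (hq2 : q ≠ 2)
    (horder : q ^ 2 ≤ orderOf (2 : ZMod q) ^ 3) {u d : ℕ} (K : ℕ) {G w : ℕ} {ψ : ℕ → ℝ}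
    (hu : 0 < u) (hψ1 : ∀ n, |ψ n| ≤ 1) (hψ : Function.Periodic ψ u) (hd : d.Coprime (q - 1))
    (hG : Nat.gcd (q - 1) u ≤ G) (hw0 : 0 < w) (hw : w ^ 6 ≤ q) :
    |∑ k ∈ range K, ψ k * (quadraticChar (ZMod q) (2 ^ (d * (k + 1) + 1) - 1) : ℝ)| ≤
      K * (G / w : ℝ) + u * orderOf (2 : ZMod q) := by
  set χ := quadraticChar (ZMod q)
  set t := orderOf (2 : ZMod q) with ht
  have h2 : (2 : ZMod q) ≠ 0 := by
    intro h
    have : ((2 : ℕ) : ZMod q) = 0 := by exact_mod_cast h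
    rw [ZMod.natCast_eq_zero_iff] at this
    exact hq2 ((Nat.prime_dvd_prime_iff_eq hq.out Nat.prime_two).mp this)
  have htq : t ∣ q - 1 := orderOf_dvd_of_pow_eq_one (ZMod.pow_card_sub_one_eq_one h2)
  have hq1 : 0 < q - 1 := Nat.sub_pos_of_lt hq.out.one_lt
  have ht0 : 0 < t := Nat.pos_of_dvd_of_pos htq hq1
  have h2t : (2 : ZMod q) ^ t = 1 := pow_orderOf_eq_one _
  have hwq : w ^ 2 * q ≤ t ^ 2 := by
    refine le_of_pow_le_pow_left₀ three_ne_zero (Nat.zero_le _) ?_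
    calc (w ^ 2 * q) ^ 3 = w ^ 6 * q ^ 3 := by ring
      _ ≤ q * q ^ 3 := by gcongr
      _ = (q ^ 2) ^ 2 := by ring
      _ ≤ (t ^ 3) ^ 2 := by gcongr
      _ = (t ^ 2) ^ 3 := by ring
  have hinner : ∀ a, |∑ j ∈ range t, (χ (2 ^ (d * (a + u * j + 1) + 1) - 1) : ℝ)| ≤
      G * (t / w : ℝ) := by
    intro a
    set g : ZMod q := 2 ^ (d * u) with hgdef
    set c : ZMod q := 2 ^ (d * (a + 1) + 1) with hcdef
    have hg : g ≠ 0 := pow_ne_zero _ h2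
    have hc : c ≠ 0 := pow_ne_zero _ h2
    have horder : orderOf g = t / t.gcd (d * u) := orderOf_pow' _ (by
      refine mul_ne_zero (fun h0 => hq2 ?_) hu.ne'
      rw [h0, Nat.coprime_zero_left] at hd
      omega)
    have hgcd : t.gcd (d * u) ≤ G := by
      rw [Nat.Coprime.gcd_mul_left_cancel_right u (hd.coprime_dvd_right htq)]
      exact (Nat.le_of_dvd (Nat.gcd_pos_of_pos_left _ hq1)
        (Nat.gcd_dvd_gcd_of_dvd_left u htq)).trans hG
    have hte : t = orderOf g * t.gcd (d * u) := by
      rw [horder, Nat.div_mul_cancel (Nat.gcd_dvd_left _ _)]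
    have hrew : ∀ j, (2 : ZMod q) ^ (d * (a + u * j + 1) + 1) = c * g ^ j := by
      intro j
      rw [hgdef, hcdef, ← pow_mul, ← pow_add]
      ring_nf
    have hper : Function.Periodic (fun j : ℕ => (χ (c * g ^ j - 1) : ℝ)) (orderOf g) := by
      intro j
      simp [pow_add, pow_orderOf_eq_one]
    simp only [hrew]
    have hsq := sq_sum_quadraticChar_geom_le hq2 hc hg
    set s := ∑ j ∈ range (orderOf g), χ (c * g ^ j - 1) with hs
    have hsum : ∑ j ∈ range t, (χ (c * g ^ j - 1) : ℝ) = (t.gcd (d * u) : ℕ) * (s : ℝ) := by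
      conv_lhs => rw [hte]
      rw [hper.sum_range_mul, hs, Int.cast_sum]
    rw [hsum, abs_mul, Nat.abs_cast]
    have hws : |(s : ℝ)| ≤ t / w := by
      rw [le_div_iff₀ (by exact_mod_cast hw0)]
      have hsq' : (s : ℝ) ^ 2 ≤ q := by exact_mod_cast hsq
      have hwq' : (w : ℝ) ^ 2 * q ≤ t ^ 2 := by exact_mod_cast hwq
      have h3 : ((s : ℝ) * w) ^ 2 ≤ (t : ℝ) ^ 2 := by
        calc ((s : ℝ) * w) ^ 2 = (w : ℝ) ^ 2 * (s : ℝ) ^ 2 := by ring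
          _ ≤ (w : ℝ) ^ 2 * q := by gcongr
          _ ≤ _ := hwq'
      have h4 := abs_le_of_sq_le_sq h3 (by positivity)
      rwa [abs_mul, Nat.abs_cast] at h4
    gcongr
  refine (Function.Periodic.abs_sum_range_le (T := u * t) (E := G / w) (by positivity)
    ?_ ?_ ?_ K).trans
    (by push_cast; rfl)
  · intro k
    have h1 : ψ (k + u * t) = ψ k := by
      have := hψ.nat_mul t k
      simpa [mul_comm] using this
    have h3 : (2 : ZMod q) ^ (d * (k + u * t + 1) + 1) = 2 ^ (d * (k + 1) + 1) := by
      rw [show d * (k + u * t + 1) + 1 = d * (k + 1) + 1 + t * (d * u) by ring, pow_add, pow_mul,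
        h2t, one_pow, mul_one]
    simp only [h1, h3]
  · intro n
    rw [abs_mul]
    refine mul_le_one₀ (hψ1 n) (abs_nonneg _) ?_
    exact_mod_cast quadraticChar_abs_le_one _
  · rw [sum_range_mul_eq_sum_sum]
    refine (abs_sum_le_sum_abs _ _).trans ((sum_le_card_nsmul _ _ (G * (t / w : ℝ)) ?_).trans ?_)
    · intro a _
      have h1 : ∀ j, ψ (a + u * j) = ψ a := by
        intro j
        have := hψ.nat_mul j a
        simpa [mul_comm] using this
      simp only [h1]
      rw [← mul_sum, abs_mul]
      exact (mul_le_of_le_one_left (abs_nonneg _) (hψ1 a)).trans (hinner a)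
    · simp only [card_range, nsmul_eq_mul, Nat.cast_mul]
      apply le_of_eq
      ring

theorem abs_sum_mul_indicator_pow_le {q : ℕ} [hq : Fact q.Prime] (hq64 : 64 ≤ q)
    (horder : orderOf (2 : ZMod q) ^ 3 < q ^ 2) {d m : ℕ} (K : ℕ) {ψ : ℕ → ℝ}
    (hψ1 : ∀ n, |ψ n| ≤ 1) (hd : d.Coprime (q - 1)) (hm0 : 0 < m)
    (hm : 2 * m ^ 3 ≤ orderOf (2 : ZMod q)) :
    |∑ k ∈ range K, ψ k * (if ((2 : ZMod q) ^ (d * (k + 1) + 1) - 1) ^ orderOf (2 : ZMod q) = 1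
      then 1 else 0)| ≤ K * (5 / m : ℝ) + orderOf (2 : ZMod q) := by
  set t := orderOf (2 : ZMod q) with ht
  have h2 : (2 : ZMod q) ≠ 0 := by
    intro h
    have : ((2 : ℕ) : ZMod q) = 0 := by exact_mod_cast h
    rw [ZMod.natCast_eq_zero_iff] at this
    have := Nat.le_of_dvd two_pos this
    omega
  have htq : t ∣ q - 1 := orderOf_dvd_of_pow_eq_one (ZMod.pow_card_sub_one_eq_one h2)
  have hq1 : 0 < q - 1 := Nat.sub_pos_of_lt hq.out.one_lt
  have ht0 : 0 < t := Nat.pos_of_dvd_of_pos htq hq1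
  have h2t : (2 : ZMod q) ^ t = 1 := pow_orderOf_eq_one _
  have hfin : IsOfFinOrder (2 : ZMod q) := orderOf_pos_iff.mp ht0
  have hm0' : (0 : ℝ) < m := by exact_mod_cast hm0
  have h4t : 4 * t ≤ q := by
    refine le_of_pow_le_pow_left₀ three_ne_zero (Nat.zero_le _) ?_
    calc (4 * t) ^ 3 = 64 * t ^ 3 := by ring
      _ ≤ q * q ^ 2 := by gcongr
      _ = q ^ 3 := by ring
  have hmt : 2 * m * t ≤ q := by
    refine le_of_pow_le_pow_left₀ three_ne_zero (Nat.zero_le _) ?_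
    calc (2 * m * t) ^ 3 = 4 * (2 * m ^ 3) * t ^ 3 := by ring
      _ ≤ 4 * t * q ^ 2 := by gcongr
      _ ≤ q * q ^ 2 := by gcongr
      _ = q ^ 3 := by ring
  set f : ℕ → ℝ := fun k => if ((2 : ZMod q) ^ (d * (k + 1) + 1) - 1) ^ t = 1 then 1 else 0 with hf
  have hf0 : ∀ k, 0 ≤ f k := fun k => by simp only [hf]; split_ifs <;> norm_num
  have hf1 : ∀ k, |f k| ≤ 1 := fun k => by simp only [hf]; split_ifs <;> norm_num
  have hle : |∑ k ∈ range K, ψ k * f k| ≤ |∑ k ∈ range K, f k| := by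
    rw [abs_of_nonneg (sum_nonneg fun k _ => hf0 k)]
    refine (abs_sum_le_sum_abs _ _).trans (sum_le_sum fun k _ => ?_)
    rw [abs_mul, abs_of_nonneg (hf0 k)]
    exact mul_le_of_le_one_left (hf0 k) (hψ1 k)
  refine hle.trans (Function.Periodic.abs_sum_range_le ht0 ?_ hf1 ?_ K)
  · intro k
    have h3 : (2 : ZMod q) ^ (d * (k + t + 1) + 1) = 2 ^ (d * (k + 1) + 1) := by
      rw [show d * (k + t + 1) + 1 = d * (k + 1) + 1 + t * d by ring, pow_add, pow_mul,
        h2t, one_pow, mul_one]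
    simp only [hf, h3]
  · rw [abs_of_nonneg (sum_nonneg fun k _ => hf0 k), hf, sum_boole]
    set F := (range t).filter fun k => ((2 : ZMod q) ^ (d * (k + 1) + 1) - 1) ^ t = 1
    have hinj : Set.InjOn (fun k => (2 : ZMod q) ^ (d * (k + 1) + 1)) F := by
      intro i hi j hj hij
      have hi := mem_range.mp (mem_filter.mp (mem_coe.mp hi)).1
      have hj := mem_range.mp (mem_filter.mp (mem_coe.mp hj)).1
      have h1 : d * (i + 1) + 1 ≡ d * (j + 1) + 1 [MOD t] := hfin.pow_eq_pow_iff_modEq.mp hij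
      have h3 : i ≡ j [MOD t] := (Nat.ModEq.cancel_left_of_coprime
        (hd.coprime_dvd_right htq).symm (h1.add_right_cancel' 1)).add_right_cancel' 1
      exact h3.eq_of_lt_of_lt hi hj
    have hcard := card_mul_le_of_pow_eq_one hm0 hm hmt
      (F.image fun k => (2 : ZMod q) ^ (d * (k + 1) + 1)) (by
        intro x hx
        obtain ⟨k, hk, rfl⟩ := mem_image.mp hx
        refine ⟨?_, (mem_filter.mp hk).2⟩
        rw [pow_right_comm, h2t, one_pow])
    rw [card_image_of_injOn hinj] at hcard
    rw [div_mul_eq_mul_div, le_div_iff₀ hm0']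
    exact_mod_cast hcard

theorem exists_weight {q : ℕ} (hq : q.Prime) (hq8 : q % 8 = 7) (hq64 : 64 ≤ q) :
    ∃ φ : ℕ → ℝ, (∀ n, |φ n| ≤ 1) ∧ Function.Periodic φ (q - 1) ∧
      (∀ n j : ℕ, (2 : ZMod q) ^ (n + 1) - 1 = 2 ^ j → φ n = 1) ∧
      ∀ (u d K G m w : ℕ) (ψ : ℕ → ℝ), 0 < u → (∀ n, |ψ n| ≤ 1) → Function.Periodic ψ u →
        d.Coprime (q - 1) → Nat.gcd (q - 1) u ≤ G → 0 < w → w ^ 6 ≤ q → 0 < m →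
        2 ^ (2 * m ^ 3) ≤ q →
        |∑ k ∈ range K, ψ k * φ (d * (k + 1))| ≤ K * (5 / m + G / w : ℝ) + u * q := by
  have : Fact q.Prime := ⟨hq⟩
  have hq2 : q ≠ 2 := by omega
  set t := orderOf (2 : ZMod q) with ht
  have h2 : (2 : ZMod q) ≠ 0 := by
    intro h
    have : ((2 : ℕ) : ZMod q) = 0 := by exact_mod_cast h
    rw [ZMod.natCast_eq_zero_iff] at this
    have := Nat.le_of_dvd two_pos this
    omega
  have hpow : (2 : ZMod q) ^ (q - 1) = 1 := ZMod.pow_card_sub_one_eq_one h2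
  have htq : (t : ℝ) ≤ q := by
    have := Nat.le_of_dvd (Nat.sub_pos_of_lt hq.one_lt) (orderOf_dvd_of_pow_eq_one hpow)
    exact_mod_cast this.trans (Nat.sub_le q 1)
  have hper : ∀ n, (2 : ZMod q) ^ (n + (q - 1) + 1) = 2 ^ (n + 1) := fun n => by
    rw [show n + (q - 1) + 1 = n + 1 + (q - 1) by ring, pow_add, hpow, mul_one]
  by_cases horder : q ^ 2 ≤ t ^ 3
  · refine ⟨fun n => (quadraticChar (ZMod q) (2 ^ (n + 1) - 1) : ℝ), ?_, ?_, ?_, ?_⟩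
    · intro n
      dsimp only
      have h3 := Int.cast_le (R := ℝ).mpr (quadraticChar_abs_le_one ((2 : ZMod q) ^ (n + 1) - 1))
      rwa [Int.cast_abs, Int.cast_one] at h3
    · intro n
      simp only [hper]
    · intro n j hj
      have h3 : quadraticChar (ZMod q) 2 = 1 := by
        rw [quadraticChar_one_iff_isSquare h2]
        exact (ZMod.exists_sq_eq_two_iff hq2).mpr (Or.inr hq8)
      dsimp only
      rw [hj, map_pow, h3, one_pow, Int.cast_one]
    · intro u d K G m w ψ hu hψ1 hψ hd hG hw0 hw hm0 hm
      refine (abs_sum_mul_quadraticChar_le hq2 horder K hu hψ1 hψ hd hG hw0 hw).trans ?_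
      have : (0 : ℝ) ≤ 5 / m := by positivity
      gcongr
      linarith
  · refine ⟨fun n => if ((2 : ZMod q) ^ (n + 1) - 1) ^ t = 1 then 1 else 0, ?_, ?_, ?_, ?_⟩
    · intro n
      dsimp only
      split_ifs <;> norm_num
    · intro n
      simp only [hper]
    · intro n j hj
      dsimp only
      rw [hj, pow_right_comm, pow_orderOf_eq_one, one_pow, if_pos rfl]
    · intro u d K G m w ψ hu hψ1 hψ hd hG hw0 hw hm0 hm
      have hmt : 2 * m ^ 3 ≤ t :=
        ((Nat.pow_lt_pow_iff_right one_lt_two).mp (hm.trans_lt (lt_two_pow_orderOf_two hq2))).le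
      refine (abs_sum_mul_indicator_pow_le hq64 (not_le.mp horder) K hψ1 hd hm0 hmt).trans ?_
      have : (0 : ℝ) ≤ G / w := by positivity
      have hu' : (1 : ℝ) ≤ u := by exact_mod_cast hu
      have : (t : ℝ) ≤ u * q := htq.trans (le_mul_of_one_le_left (by positivity) hu')
      gcongr
      linarith

end Weights

section SecondMoment

open Finset

theorem sum_Ioc_filter_dvd {M : Type*} [AddCommMonoid M] {d : ℕ} (hd : 0 < d) (N : ℕ) (F : ℕ → M) :
    ∑ n ∈ Ioc 0 N with d ∣ n, F n = ∑ k ∈ range (N / d), F (d * (k + 1)) := by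
  symm
  refine sum_bij (fun k _ => d * (k + 1)) ?_ ?_ ?_ fun _ _ => rfl
  · intro k hk
    have hk := mem_range.mp hk
    rw [mem_filter, mem_Ioc]
    refine ⟨⟨by positivity, ?_⟩, dvd_mul_right _ _⟩
    rw [mul_comm]
    exact (Nat.le_div_iff_mul_le hd).mp hk
  · intro i _ j _ hij
    have := Nat.eq_of_mul_eq_mul_left hd hij
    omega
  · intro n hn
    obtain ⟨hn, l, rfl⟩ := mem_filter.mp hn
    obtain ⟨h0, h1⟩ := mem_Ioc.mp hn
    have hl : 0 < l := Nat.pos_of_mul_pos_left h0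
    refine ⟨l - 1, ?_, by rw [Nat.sub_add_cancel hl]⟩
    rw [mem_range]
    have : l ≤ N / d := (Nat.le_div_iff_mul_le hd).mpr (by rwa [mul_comm])
    omega

theorem sum_sq_sum_dvd_le {P : Finset ℕ} (hP : ∀ p ∈ P, p.Prime) {φ : ℕ → ℕ → ℝ}
    (hφ : ∀ p ∈ P, ∀ n, |φ p n| ≤ 1) (N : ℕ) :
    ∑ n ∈ Ioc 0 N, (∑ p ∈ P with p ∣ n, φ p n) ^ 2 ≤
      N * ∑ p ∈ P, (1 / p : ℝ) + ∑ p ∈ P, ∑ q ∈ P.erase p,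
        |∑ k ∈ range (N / (p * q)), φ p (p * q * (k + 1)) * φ q (p * q * (k + 1))| := by
  have h1 : ∑ n ∈ Ioc 0 N, (∑ p ∈ P with p ∣ n, φ p n) ^ 2 =
      ∑ p ∈ P, ∑ q ∈ P, ∑ n ∈ Ioc 0 N, if p ∣ n ∧ q ∣ n then φ p n * φ q n else 0 := by
    have : ∀ n, (∑ p ∈ P with p ∣ n, φ p n) ^ 2 =
        ∑ p ∈ P, ∑ q ∈ P, if p ∣ n ∧ q ∣ n then φ p n * φ q n else 0 := by
      intro n
      rw [sq, sum_filter, sum_mul_sum]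
      refine sum_congr rfl fun p _ => sum_congr rfl fun q _ => ?_
      by_cases h1 : p ∣ n <;> by_cases h2 : q ∣ n <;> simp [h1, h2]
    simp only [this]
    rw [sum_comm]
    exact sum_congr rfl fun p _ => sum_comm
  rw [h1, mul_sum, ← sum_add_distrib]
  refine sum_le_sum fun p hp => ?_
  rw [← add_sum_erase _ _ hp]
  refine add_le_add ?_ (sum_le_sum fun q hq => ?_)
  · rw [← sum_filter]
    simp only [and_self]
    rw [sum_Ioc_filter_dvd (hP p hp).pos]
    refine (sum_le_card_nsmul _ _ 1 fun k _ => ?_).trans ?_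
    · refine (le_abs_self _).trans ?_
      rw [abs_mul]
      exact mul_le_one₀ (hφ p hp _) (abs_nonneg _) (hφ p hp _)
    · simp only [card_range, nsmul_eq_mul, mul_one, mul_one_div]
      exact Nat.cast_div_le
  · obtain ⟨hqp, hq⟩ := mem_erase.mp hq
    refine le_trans (le_of_eq ?_) (le_abs_self _)
    have hcop : p.Coprime q := (Nat.coprime_primes (hP p hp) (hP q hq)).mpr (Ne.symm hqp)
    rw [← sum_Ioc_filter_dvd (Nat.mul_pos (hP p hp).pos (hP q hq).pos) N
      (fun n => φ p n * φ q n), sum_filter]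
    refine sum_congr rfl fun n _ => ?_
    have : p ∣ n ∧ q ∣ n ↔ p * q ∣ n :=
      ⟨fun h => hcop.mul_dvd_of_dvd_of_dvd h.1 h.2,
        fun h => ⟨(dvd_mul_right p q).trans h, (dvd_mul_left q p).trans h⟩⟩
    simp only [this]

theorem sum_sq_card_dvd_sub_le {P : Finset ℕ} (hP : ∀ p ∈ P, p.Prime) (N : ℕ) :
    ∑ n ∈ Ioc 0 N, ((#{p ∈ P | p ∣ n} : ℝ) - ∑ p ∈ P, (1 / p : ℝ)) ^ 2 ≤
      N * ∑ p ∈ P, (1 / p : ℝ) + 2 * (∑ p ∈ P, (1 / p : ℝ)) * #P := by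
  set S := ∑ p ∈ P, (1 / p : ℝ) with hS
  have hS0 : 0 ≤ S := sum_nonneg fun p _ => by positivity
  have h1 : ∑ n ∈ Ioc 0 N, (#{p ∈ P | p ∣ n} : ℝ) ^ 2 ≤ N * S + N * S ^ 2 := by
    have h := sum_sq_sum_dvd_le hP (φ := fun _ _ => 1) (fun _ _ _ => by simp) N
    simp only [sum_const, nsmul_eq_mul, mul_one, card_range, Nat.abs_cast] at h
    refine h.trans (add_le_add le_rfl ?_)
    calc ∑ p ∈ P, ∑ q ∈ P.erase p, ((N / (p * q) : ℕ) : ℝ)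
        ≤ ∑ p ∈ P, ∑ q ∈ P, ((N / (p * q) : ℕ) : ℝ) :=
          sum_le_sum fun p _ => sum_le_sum_of_subset_of_nonneg (erase_subset _ _)
            fun _ _ _ => Nat.cast_nonneg _
      _ ≤ ∑ p ∈ P, ∑ q ∈ P, (N * ((1 / p) * (1 / q)) : ℝ) := by
          refine sum_le_sum fun p _ => sum_le_sum fun q _ => Nat.cast_div_le.trans (le_of_eq ?_)
          push_cast
          ring
      _ = N * S ^ 2 := by
          rw [sq, hS, sum_mul_sum, mul_sum]
          simp only [mul_sum]
  have h2 : N * S - #P ≤ ∑ n ∈ Ioc 0 N, (#{p ∈ P | p ∣ n} : ℝ) := by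
    have h3 : ∑ n ∈ Ioc 0 N, (#{p ∈ P | p ∣ n} : ℝ) = ∑ p ∈ P, ((N / p : ℕ) : ℝ) := by
      have : ∀ n, (#{p ∈ P | p ∣ n} : ℝ) = ∑ p ∈ P, if p ∣ n then 1 else 0 := fun n => by
        rw [sum_boole]
      simp only [this]
      rw [sum_comm]
      refine sum_congr rfl fun p hp => ?_
      rw [← sum_filter, sum_Ioc_filter_dvd (hP p hp).pos]
      simp
    rw [h3, hS, mul_sum, card_eq_sum_ones, Nat.cast_sum, ← sum_sub_distrib]
    refine sum_le_sum fun p hp => ?_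
    have := Nat.lt_floor_add_one ((N : ℝ) / p)
    rw [Nat.floor_div_eq_div] at this
    rw [mul_one_div, Nat.cast_one]
    linarith
  have h4 : ∑ n ∈ Ioc 0 N, ((#{p ∈ P | p ∣ n} : ℝ) - S) ^ 2 =
      ∑ n ∈ Ioc 0 N, (#{p ∈ P | p ∣ n} : ℝ) ^ 2 -
        2 * S * ∑ n ∈ Ioc 0 N, (#{p ∈ P | p ∣ n} : ℝ) + N * S ^ 2 := by
    have : (N : ℝ) * S ^ 2 = ∑ n ∈ Ioc 0 N, S ^ 2 := by simp
    rw [this, mul_sum, ← sum_sub_distrib, ← sum_add_distrib]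
    refine sum_congr rfl fun n _ => by ring
  rw [h4]
  nlinarith [mul_le_mul_of_nonneg_left h2 hS0]

theorem sum_inv_filter_dvd_sub_one_le {P : Finset ℕ} {Y r : ℕ} (hP : ∀ p ∈ P, 1 < p ∧ p ≤ Y)
    (hr : 0 < r) :
    ∑ p ∈ P with r ∣ p - 1, (1 / p : ℝ) ≤ (1 + Real.log Y) / r := by
  have hharm : ∑ l ∈ Icc 1 Y, (1 / l : ℝ) ≤ 1 + Real.log Y := by
    have := harmonic_le_one_add_log Y
    rw [harmonic_eq_sum_Icc] at this
    push_cast at this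
    simpa using this
  have hinj : Set.InjOn (fun p => (p - 1) / r) (P.filter (r ∣ · - 1) : Finset ℕ) := by
    intro p hp q hq hpq
    obtain ⟨hp, hp'⟩ := mem_filter.mp (mem_coe.mp hp)
    obtain ⟨hq, hq'⟩ := mem_filter.mp (mem_coe.mp hq)
    have := Nat.div_left_inj hp' hq' |>.mp hpq
    have := hP p hp
    have := hP q hq
    omega
  calc ∑ p ∈ P with r ∣ p - 1, (1 / p : ℝ)
      ≤ ∑ p ∈ P with r ∣ p - 1, (1 / r : ℝ) * (1 / ((p - 1) / r : ℕ)) := by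
        refine sum_le_sum fun p hp => ?_
        obtain ⟨hp, l, hl⟩ := mem_filter.mp hp
        have hp1 := hP p hp
        have hl0 : 0 < l := by
          rcases Nat.eq_zero_or_pos l with rfl | h
          · omega
          · exact h
        rw [hl, Nat.mul_div_cancel_left _ hr, one_div_mul_one_div]
        refine one_div_le_one_div_of_le (by positivity) ?_
        exact_mod_cast (hl.symm.le.trans (Nat.sub_le p 1))
    _ = (1 / r : ℝ) * ∑ l ∈ (P.filter (r ∣ · - 1)).image (fun p => (p - 1) / r), (1 / l : ℝ) := by
        rw [sum_image hinj, mul_sum]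
    _ ≤ (1 / r : ℝ) * ∑ l ∈ Icc 1 Y, (1 / l : ℝ) := by
        refine mul_le_mul_of_nonneg_left ?_ (by positivity)
        refine sum_le_sum_of_subset_of_nonneg ?_ fun _ _ _ => by positivity
        intro l hl
        obtain ⟨p, hp, rfl⟩ := mem_image.mp hl
        obtain ⟨hp, l, hl⟩ := mem_filter.mp hp
        have hp1 := hP p hp
        rw [hl, Nat.mul_div_cancel_left _ hr, mem_Icc]
        have hl0 : 0 < l := by
          rcases Nat.eq_zero_or_pos l with rfl | h
          · omega
          · exact h
        refine ⟨hl0, ?_⟩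
        have := Nat.le_mul_of_pos_left l hr
        omega
    _ ≤ (1 / r : ℝ) * (1 + Real.log Y) := by gcongr
    _ = _ := by ring

theorem sum_Ioc_one_div_sq_le {z : ℕ} (hz : 0 < z) (Y : ℕ) :
    ∑ n ∈ Ioc z Y, (1 / n : ℝ) ^ 2 ≤ 1 / z := by
  rcases le_total z Y with h | h
  · have h1 := sum_Ioc_inv_sq_le_sub (α := ℝ) hz.ne' h
    have h2 : (0 : ℝ) ≤ (Y : ℝ)⁻¹ := by positivity
    simp only [one_div, inv_pow]
    linarith
  · rw [Ioc_eq_empty (by omega), sum_empty]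
    positivity

theorem sum_sum_filter_dvd_sub_one_le {P : Finset ℕ} {z Y : ℕ} (hz : 0 < z)
    (hP : ∀ p ∈ P, z < p ∧ p ≤ Y) :
    ∑ p ∈ P, ∑ q ∈ P with p ∣ q - 1, (1 / (p * q) : ℝ) ≤ (1 + Real.log Y) / z := by
  have hY0 : 0 ≤ Real.log Y := Real.log_natCast_nonneg Y
  calc ∑ p ∈ P, ∑ q ∈ P with p ∣ q - 1, (1 / (p * q) : ℝ)
      ≤ ∑ p ∈ P, (1 + Real.log Y) * (1 / p : ℝ) ^ 2 := by
        refine sum_le_sum fun p hp => ?_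
        have h := sum_inv_filter_dvd_sub_one_le (P := P) (Y := Y) (r := p)
          (fun q hq => by have := hP q hq; omega)
          (by have := hP p hp; omega)
        calc ∑ q ∈ P with p ∣ q - 1, (1 / (p * q) : ℝ)
            = (1 / p : ℝ) * ∑ q ∈ P with p ∣ q - 1, (1 / q : ℝ) := by
              rw [mul_sum]
              simp only [one_div_mul_one_div]
          _ ≤ (1 / p : ℝ) * ((1 + Real.log Y) / p) := by gcongr
          _ = _ := by ring
    _ ≤ ∑ p ∈ Ioc z Y, (1 + Real.log Y) * (1 / p : ℝ) ^ 2 :=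
        sum_le_sum_of_subset_of_nonneg (fun p hp => mem_Ioc.mpr (hP p hp))
          fun _ _ _ => by positivity
    _ ≤ (1 + Real.log Y) * (1 / z) := by
        rw [← mul_sum]
        exact mul_le_mul_of_nonneg_left (sum_Ioc_one_div_sq_le hz Y) (by positivity)
    _ = _ := by ring

theorem sum_sum_filter_lt_gcd_le {P : Finset ℕ} {G Y : ℕ} (hG : 0 < G)
    (hP : ∀ p ∈ P, 1 < p ∧ p ≤ Y) :
    ∑ p ∈ P, ∑ q ∈ P with G < Nat.gcd (p - 1) (q - 1), (1 / (p * q) : ℝ) ≤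
      (1 + Real.log Y) ^ 2 / G := by
  have hY0 : 0 ≤ Real.log Y := Real.log_natCast_nonneg Y
  calc ∑ p ∈ P, ∑ q ∈ P with G < Nat.gcd (p - 1) (q - 1), (1 / (p * q) : ℝ)
      ≤ ∑ p ∈ P, ∑ q ∈ P, ∑ r ∈ Ioc G Y,
          if r ∣ p - 1 ∧ r ∣ q - 1 then (1 / (p * q) : ℝ) else 0 := by
        refine sum_le_sum fun p hp => ?_
        rw [sum_filter]
        refine sum_le_sum fun q hq => ?_
        have hnn : ∀ r ∈ Ioc G Y, (0 : ℝ) ≤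
            if r ∣ p - 1 ∧ r ∣ q - 1 then (1 / (p * q) : ℝ) else 0 := fun r _ => by
          split_ifs <;> positivity
        split_ifs with h
        · have hmem : Nat.gcd (p - 1) (q - 1) ∈ Ioc G Y := by
            have h1 := hP p hp
            have h2 := Nat.gcd_le_left (q - 1) (show 0 < p - 1 by omega)
            rw [mem_Ioc]
            omega
          refine le_trans (le_of_eq ?_) (single_le_sum hnn hmem)
          rw [if_pos ⟨Nat.gcd_dvd_left _ _, Nat.gcd_dvd_right _ _⟩]
        · exact sum_nonneg hnn
    _ = ∑ r ∈ Ioc G Y, (∑ p ∈ P with r ∣ p - 1, (1 / p : ℝ)) ^ 2 := by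
        have : ∀ r, (∑ p ∈ P with r ∣ p - 1, (1 / p : ℝ)) ^ 2 = ∑ p ∈ P, ∑ q ∈ P,
            if r ∣ p - 1 ∧ r ∣ q - 1 then (1 / (p * q) : ℝ) else 0 := by
          intro r
          rw [sq, sum_filter, sum_mul_sum]
          refine sum_congr rfl fun p _ => sum_congr rfl fun q _ => ?_
          by_cases h1 : r ∣ p - 1 <;> by_cases h2 : r ∣ q - 1 <;>
            simp [h1, h2, mul_comm]
        simp only [this]
        symm
        rw [sum_comm]
        exact sum_congr rfl fun p _ => sum_comm
    _ ≤ ∑ r ∈ Ioc G Y, (1 + Real.log Y) ^ 2 * (1 / r : ℝ) ^ 2 := by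
        refine sum_le_sum fun r hr => ?_
        have hr0 : 0 < r := hG.trans (mem_Ioc.mp hr).1
        have h := sum_inv_filter_dvd_sub_one_le hP hr0
        rw [← mul_pow, mul_one_div]
        exact pow_le_pow_left₀ (sum_nonneg fun _ _ => by positivity) h 2
    _ ≤ (1 + Real.log Y) ^ 2 * (1 / G) := by
        rw [← mul_sum]
        exact mul_le_mul_of_nonneg_left (sum_Ioc_one_div_sq_le hG Y) (by positivity)
    _ = _ := by ring

end SecondMoment

section Counting

open Finset

theorem abs_sum_mul_weight_le {p q N G m w : ℕ} {φ φ' : ℕ → ℝ} (hp : p.Prime) (hq : q.Prime)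
    (hφ1 : ∀ n, |φ n| ≤ 1) (hφ1' : ∀ n, |φ' n| ≤ 1)
    (hφ : Function.Periodic φ (p - 1))
    (hφ' : ∀ (u d K : ℕ) (ψ : ℕ → ℝ), 0 < u → (∀ n, |ψ n| ≤ 1) → Function.Periodic ψ u →
      d.Coprime (q - 1) → Nat.gcd (q - 1) u ≤ G →
      |∑ k ∈ range K, ψ k * φ' (d * (k + 1))| ≤ K * (5 / m + G / w : ℝ) + u * q) :
    |∑ k ∈ range (N / (p * q)), φ (p * q * (k + 1)) * φ' (p * q * (k + 1))| ≤
      N * (1 / (p * q) : ℝ) * ((5 / m + G / w) + (if p ∣ q - 1 then 1 else 0) +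
        (if q ∣ p - 1 then 1 else 0) + (if G < Nat.gcd (p - 1) (q - 1) then 1 else 0)) +
        p * q := by
  have hK : ((N / (p * q) : ℕ) : ℝ) ≤ N * (1 / (p * q) : ℝ) := by
    refine Nat.cast_div_le.trans (le_of_eq ?_)
    push_cast
    ring
  have hε : (0 : ℝ) ≤ 5 / m + G / w := by positivity
  have hind : ∀ (r : Prop) [Decidable r], (0 : ℝ) ≤ if r then 1 else 0 := fun r _ => by
    split_ifs <;> norm_num
  have h3 := hind (q ∣ p - 1)
  have hpq0 : (0 : ℝ) ≤ N * (1 / (p * q) : ℝ) := by positivity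
  have hpq1 : (0 : ℝ) ≤ p * q := by positivity
  have htriv : |∑ k ∈ range (N / (p * q)), φ (p * q * (k + 1)) * φ' (p * q * (k + 1))| ≤
      N * (1 / (p * q) : ℝ) := by
    refine le_trans ?_ hK
    refine (abs_sum_le_sum_abs _ _).trans ((sum_le_card_nsmul _ _ 1 fun k _ => ?_).trans (by simp))
    rw [abs_mul]
    exact mul_le_one₀ (hφ1 _) (abs_nonneg _) (hφ1' _)
  by_cases h1 : p ∣ q - 1
  · have h4 := hind (G < Nat.gcd (p - 1) (q - 1))
    rw [if_pos h1]
    nlinarith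
  by_cases h2 : G < Nat.gcd (p - 1) (q - 1)
  · rw [if_pos h2, if_neg h1]
    nlinarith
  have hu : 0 < p - 1 := Nat.sub_pos_of_lt hp.one_lt
  have hcop : (p * q).Coprime (q - 1) := by
    refine Nat.Coprime.mul_left ((Nat.Prime.coprime_iff_not_dvd hp).mpr h1)
      ((Nat.Prime.coprime_iff_not_dvd hq).mpr fun h => ?_)
    have := Nat.le_of_dvd (Nat.sub_pos_of_lt hq.one_lt) h
    have := hq.one_lt
    omega
  have hper : Function.Periodic (fun k => φ (p * q * (k + 1))) (p - 1) := by
    intro k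
    have := hφ.nat_mul (p * q) (p * q * (k + 1))
    have h5 : p * q * (k + (p - 1) + 1) = p * q * (k + 1) + p * q * (p - 1) := by ring
    dsimp only
    rw [h5]
    exact_mod_cast this
  have h := hφ' (p - 1) (p * q) (N / (p * q)) _ hu (fun n => hφ1 _) hper hcop
    (by rw [Nat.gcd_comm]; exact not_lt.mp h2)
  refine h.trans (add_le_add ?_ ?_)
  · rw [if_neg h1, if_neg h2]
    exact mul_le_mul hK (by linarith) hε hpq0
  · gcongr
    exact_mod_cast Nat.sub_le p 1

theorem card_mul_sq_le {N z Y G m w : ℕ} {P T : Finset ℕ} (hz : 64 ≤ z)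
    (hP : ∀ p ∈ P, p.Prime ∧ p % 8 = 7 ∧ z < p ∧ p ≤ Y)
    (hT : ∀ n ∈ T, n ∈ setC ∧ n ≤ N) (hG : 0 < G) (hw0 : 0 < w) (hw : w ^ 6 ≤ z)
    (hm0 : 0 < m) (hm : 2 ^ (2 * m ^ 3) ≤ z) :
    #T * (∑ p ∈ P, (1 / p : ℝ)) ^ 2 ≤
      4 * N * (∑ p ∈ P, (1 / p : ℝ)) + 4 * Y ^ 2 +
      2 * N * ((5 / m + G / w) * (∑ p ∈ P, (1 / p : ℝ)) ^ 2 + 2 * ((1 + Real.log Y) / z) +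
        (1 + Real.log Y) ^ 2 / G) + 2 * Y ^ 4 := by
  set S := ∑ p ∈ P, (1 / p : ℝ) with hS
  have hex := fun p : P => exists_weight (hP p p.2).1 (hP p p.2).2.1
    (hz.trans (hP p p.2).2.2.1.le)
  choose φ₀ hφ₀1 hφ₀per hφ₀C hφ₀sum using hex
  classical
  let φ : ℕ → ℕ → ℝ := fun p => if h : p ∈ P then φ₀ ⟨p, h⟩ else 0
  have hφ : ∀ p (h : p ∈ P), φ p = φ₀ ⟨p, h⟩ := fun p h => dif_pos h
  have hφ1 : ∀ p ∈ P, ∀ n, |φ p n| ≤ 1 := fun p h n => by rw [hφ p h]; exact hφ₀1 _ n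
  have hS0 : 0 ≤ S := sum_nonneg fun p _ => by positivity
  have hPsub : P ⊆ Ioc 0 Y := fun p hp => by
    have := hP p hp
    rw [mem_Ioc]
    omega
  have hcard : (#P : ℝ) ≤ Y := by
    have := card_le_card hPsub
    rw [Nat.card_Ioc] at this
    exact_mod_cast this
  have hSY : S ≤ Y := by
    refine le_trans ?_ hcard
    refine (sum_le_card_nsmul _ _ 1 fun p hp => ?_).trans (by simp)
    rw [one_div]
    exact Nat.cast_inv_le_one p
  set ε : ℝ := 5 / m + G / w with hε
  have hcorr : ∀ p ∈ P, ∀ q ∈ P.erase p,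
      |∑ k ∈ range (N / (p * q)), φ p (p * q * (k + 1)) * φ q (p * q * (k + 1))| ≤
      N * (1 / (p * q) : ℝ) * (ε + (if p ∣ q - 1 then 1 else 0) +
        (if q ∣ p - 1 then 1 else 0) + (if G < Nat.gcd (p - 1) (q - 1) then 1 else 0)) +
        p * q := by
    intro p hp q hq
    have hq := mem_of_mem_erase hq
    refine abs_sum_mul_weight_le (hP p hp).1 (hP q hq).1 (hφ1 p hp) (hφ1 q hq) ?_ ?_
    · rw [hφ p hp]
      exact hφ₀per _
    · intro u d K ψ hu hψ1 hψ hd hg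
      rw [hφ q hq]
      have hzq := (hP q hq).2.2.1.le
      exact hφ₀sum ⟨q, hq⟩ u d K G m w ψ hu hψ1 hψ hd hg hw0 (hw.trans hzq) hm0 (hm.trans hzq)
  have hf : ∑ n ∈ Ioc 0 N, (∑ p ∈ P with p ∣ n, φ p n) ^ 2 ≤
      N * S + (N * (ε * S ^ 2 + 2 * ((1 + Real.log Y) / z) + (1 + Real.log Y) ^ 2 / G) +
        Y ^ 4) := by
    refine (sum_sq_sum_dvd_le (fun p hp => (hP p hp).1) hφ1 N).trans (add_le_add le_rfl ?_)
    calc _ ≤ ∑ p ∈ P, ∑ q ∈ P.erase p, (N * (1 / (p * q) : ℝ) *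
          (ε + (if p ∣ q - 1 then 1 else 0) + (if q ∣ p - 1 then 1 else 0) +
          (if G < Nat.gcd (p - 1) (q - 1) then 1 else 0)) + p * q) :=
          sum_le_sum fun p hp => sum_le_sum fun q hq => hcorr p hp q hq
      _ ≤ ∑ p ∈ P, ∑ q ∈ P, (N * (1 / (p * q) : ℝ) *
          (ε + (if p ∣ q - 1 then 1 else 0) + (if q ∣ p - 1 then 1 else 0) +
          (if G < Nat.gcd (p - 1) (q - 1) then 1 else 0)) + p * q) := by
          refine sum_le_sum fun p _ => sum_le_sum_of_subset_of_nonneg (erase_subset _ _)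
            fun q _ _ => ?_
          have hind : ∀ (r : Prop) [Decidable r], (0 : ℝ) ≤ if r then 1 else 0 := fun r _ => by
            split_ifs <;> norm_num
          have h1 := hind (p ∣ q - 1)
          have h2 := hind (q ∣ p - 1)
          have h3 := hind (G < Nat.gcd (p - 1) (q - 1))
          positivity
      _ = N * (ε * (∑ p ∈ P, ∑ q ∈ P, (1 / (p * q) : ℝ)) +
            (∑ p ∈ P, ∑ q ∈ P with p ∣ q - 1, (1 / (p * q) : ℝ)) +
            (∑ p ∈ P, ∑ q ∈ P with q ∣ p - 1, (1 / (p * q) : ℝ)) +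
            ∑ p ∈ P, ∑ q ∈ P with G < Nat.gcd (p - 1) (q - 1), (1 / (p * q) : ℝ)) +
          ∑ p ∈ P, ∑ q ∈ P, (p * q : ℝ) := by
          simp only [mul_add, sum_add_distrib, mul_sum, sum_filter, mul_ite, mul_one, mul_zero]
          simp only [← mul_assoc, mul_comm]
      _ ≤ N * (ε * S ^ 2 + (1 + Real.log Y) / z + (1 + Real.log Y) / z +
            (1 + Real.log Y) ^ 2 / G) + Y ^ 4 := by
          have hz0 : 0 < z := by omega
          have hP' : ∀ p ∈ P, z < p ∧ p ≤ Y := fun p hp => (hP p hp).2.2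
          have h1 : ∑ p ∈ P, ∑ q ∈ P, (1 / (p * q) : ℝ) = S ^ 2 := by
            rw [sq, hS, sum_mul_sum]
            simp only [one_div_mul_one_div]
          have h2 := sum_sum_filter_dvd_sub_one_le hz0 hP'
          have h3 : ∑ p ∈ P, ∑ q ∈ P with q ∣ p - 1, (1 / (p * q) : ℝ) =
              ∑ p ∈ P, ∑ q ∈ P with p ∣ q - 1, (1 / (p * q) : ℝ) := by
            simp only [sum_filter]
            rw [sum_comm]
            simp only [mul_comm]
          have h4 := sum_sum_filter_lt_gcd_le (P := P) (Y := Y) hG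
            (fun p hp => by have := hP' p hp; omega)
          have h5 : ∑ p ∈ P, ∑ q ∈ P, (p * q : ℝ) ≤ Y ^ 4 := by
            rw [← sum_mul_sum]
            have h6 : ∑ p ∈ P, (p : ℝ) ≤ Y * Y := by
              refine (sum_le_card_nsmul _ _ (Y : ℝ) fun p hp => ?_).trans ?_
              · exact_mod_cast (hP p hp).2.2.2
              · rw [nsmul_eq_mul]
                gcongr
            have h7 : (0 : ℝ) ≤ ∑ p ∈ P, (p : ℝ) := sum_nonneg fun _ _ => Nat.cast_nonneg _
            calc _ ≤ (Y * Y : ℝ) * (Y * Y) := by gcongr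
              _ = _ := by ring
          rw [h1, h3]
          gcongr
      _ = _ := by ring
  have hω := sum_sq_card_dvd_sub_le (fun p hp => (hP p hp).1) (P := P) N
  rw [← hS] at hω
  have hpt : ∀ n ∈ T, S ^ 2 ≤ 2 * ((#{p ∈ P | p ∣ n} : ℝ) - S) ^ 2 +
      2 * (∑ p ∈ P with p ∣ n, φ p n) ^ 2 := by
    intro n hn
    obtain ⟨⟨hn1, j, -, hj⟩, -⟩ := hT n hn
    have h1 : ∑ p ∈ P with p ∣ n, φ p n = #{p ∈ P | p ∣ n} := by
      rw [card_eq_sum_ones, Nat.cast_sum]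
      refine sum_congr rfl fun p hp => ?_
      obtain ⟨hp, hpn⟩ := mem_filter.mp hp
      rw [hφ p hp, Nat.cast_one]
      refine hφ₀C ⟨p, hp⟩ n j ?_
      have h2 := (ZMod.natCast_eq_natCast_iff _ _ _).mpr (hj.of_dvd hpn)
      rw [Nat.cast_sub Nat.one_le_two_pow] at h2
      push_cast at h2
      exact h2
    rw [h1]
    nlinarith [sq_nonneg (2 * (#{p ∈ P | p ∣ n} : ℝ) - S)]
  have hTsub : T ⊆ Ioc 0 N := fun n hn => by
    obtain ⟨⟨hn1, -⟩, h2⟩ := hT n hn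
    rw [mem_Ioc]
    omega
  have hmain : #T * S ^ 2 ≤ 2 * ∑ n ∈ Ioc 0 N, ((#{p ∈ P | p ∣ n} : ℝ) - S) ^ 2 +
      2 * ∑ n ∈ Ioc 0 N, (∑ p ∈ P with p ∣ n, φ p n) ^ 2 := by
    rw [mul_sum, mul_sum, ← sum_add_distrib, ← nsmul_eq_mul, ← sum_const]
    exact (sum_le_sum hpt).trans (sum_le_sum_of_subset_of_nonneg hTsub
      fun n _ _ => by positivity)
  have hSP : S * #P ≤ Y ^ 2 := by
    rw [sq]
    gcongr
  linarith

end Counting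

section PrimesInProgression

open Finset ArithmeticFunction ArithmeticFunction.vonMangoldt

theorem sum_vonMangoldt_div_dyadic_le (k : ℕ) :
    ∑ n ∈ Ioc (2 ^ k) (2 ^ (k + 1)), vonMangoldt n / n ≤ 11 := by
  have hpsi : ∑ n ∈ Ioc 0 (2 ^ (k + 1)), vonMangoldt n ≤ (Real.log 4 + 4) * 2 ^ (k + 1) := by
    have h := Chebyshev.psi_le_const_mul_self (x := ((2 ^ (k + 1) : ℕ) : ℝ)) (Nat.cast_nonneg _)
    rw [Chebyshev.psi, Nat.floor_natCast] at h
    exact_mod_cast h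
  have hlog : Real.log 4 ≤ 3 / 2 := by
    rw [show (4 : ℝ) = 2 ^ 2 by norm_num, Real.log_pow]
    have := Real.log_two_lt_d9
    norm_num at this ⊢
    linarith
  calc ∑ n ∈ Ioc (2 ^ k) (2 ^ (k + 1)), vonMangoldt n / n
      ≤ ∑ n ∈ Ioc (2 ^ k) (2 ^ (k + 1)), vonMangoldt n / 2 ^ k := by
        refine sum_le_sum fun n hn => ?_
        have : (2 ^ k : ℝ) ≤ n := by exact_mod_cast (mem_Ioc.mp hn).1.le
        exact div_le_div_of_nonneg_left vonMangoldt_nonneg (by positivity) this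
    _ = (∑ n ∈ Ioc (2 ^ k) (2 ^ (k + 1)), vonMangoldt n) / 2 ^ k := by rw [sum_div]
    _ ≤ (∑ n ∈ Ioc 0 (2 ^ (k + 1)), vonMangoldt n) / 2 ^ k := by
        refine div_le_div_of_nonneg_right ?_ (by positivity)
        exact sum_le_sum_of_subset_of_nonneg (Ioc_subset_Ioc_left (Nat.zero_le _))
          fun _ _ _ => vonMangoldt_nonneg
    _ ≤ (Real.log 4 + 4) * 2 ^ (k + 1) / 2 ^ k := by gcongr
    _ = (Real.log 4 + 4) * 2 := by
        rw [pow_succ]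
        field_simp
    _ ≤ 11 := by linarith

theorem sum_Ioc_two_pow_eq_sum_dyadic (f : ℕ → ℝ) {J M : ℕ} (hJM : J ≤ M) :
    ∑ n ∈ Ioc (2 ^ J) (2 ^ M), f n = ∑ k ∈ Ico J M, ∑ n ∈ Ioc (2 ^ k) (2 ^ (k + 1)), f n := by
  induction M, hJM using Nat.le_induction with
  | base => simp
  | succ M hM ih =>
    rw [sum_Ico_succ_top hM, ← ih, sum_Ioc_consecutive]
    · exact Nat.pow_le_pow_right two_pos hM
    · exact Nat.pow_le_pow_right two_pos (Nat.le_succ M)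

theorem sum_vonMangoldt_div_le (I : ℕ) :
    ∑ n ∈ Ioc 0 (2 ^ I), vonMangoldt n / n ≤ 11 * I := by
  have h0 : ∑ n ∈ Ioc 0 (2 ^ I), vonMangoldt n / n =
      ∑ n ∈ Ioc (2 ^ 0) (2 ^ I), vonMangoldt n / n := by
    rw [← sum_Ioc_consecutive _ (Nat.zero_le (2 ^ 0)) Nat.one_le_two_pow]
    rw [pow_zero, show Ioc 0 1 = {1} from rfl, sum_singleton, vonMangoldt_apply_one]
    simp
  rw [h0, sum_Ioc_two_pow_eq_sum_dyadic _ (Nat.zero_le I)]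
  refine (sum_le_card_nsmul _ _ 11 fun k _ => sum_vonMangoldt_div_dyadic_le k).trans ?_
  simp [mul_comm]

theorem half_le_one_sub_two_rpow_neg {δ : ℝ} (h0 : 0 ≤ δ) (h1 : δ ≤ 1) :
    δ / 2 ≤ 1 - (2 : ℝ) ^ (-δ) := by
  have h := rpow_one_add_le_one_add_mul_self (s := -(1 / 2)) (by norm_num) h0 h1
  rw [Real.rpow_neg two_pos.le, ← Real.inv_rpow two_pos.le]
  norm_num at h ⊢
  linarith

theorem sum_vonMangoldt_div_rpow_tail_le {δ : ℝ} (h0 : 0 < δ) (h1 : δ ≤ 1) {J M : ℕ}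
    (hJM : J ≤ M) :
    ∑ n ∈ Ioc (2 ^ J) (2 ^ M), vonMangoldt n / (n : ℝ) ^ (1 + δ) ≤
      22 * (2 : ℝ) ^ (-(J * δ)) / δ := by
  set ρ : ℝ := 2 ^ (-δ) with hρ
  have hρ0 : 0 < ρ := by positivity
  have hρ1 : ρ < 1 := Real.rpow_lt_one_of_one_lt_of_neg one_lt_two (by linarith)
  have hρδ := half_le_one_sub_two_rpow_neg h0.le h1
  have hblock : ∀ k, ∑ n ∈ Ioc (2 ^ k) (2 ^ (k + 1)), vonMangoldt n / (n : ℝ) ^ (1 + δ) ≤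
      11 * ρ ^ k := by
    intro k
    calc _ ≤ ∑ n ∈ Ioc (2 ^ k) (2 ^ (k + 1)), vonMangoldt n / n * ρ ^ k := by
          refine sum_le_sum fun n hn => ?_
          have hn' : (2 ^ k : ℝ) ≤ n := by exact_mod_cast (mem_Ioc.mp hn).1.le
          have hn0 : (0 : ℝ) < n := lt_of_lt_of_le (by positivity) hn'
          rw [Real.rpow_add hn0, Real.rpow_one, ← div_div, div_eq_mul_inv _ ((n : ℝ) ^ δ)]
          refine mul_le_mul_of_nonneg_left ?_ (div_nonneg vonMangoldt_nonneg hn0.le)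
          rw [hρ, ← Real.rpow_natCast, ← Real.rpow_mul two_pos.le, ← Real.rpow_neg hn0.le]
          calc (n : ℝ) ^ (-δ) ≤ (2 ^ k : ℝ) ^ (-δ) :=
                Real.rpow_le_rpow_of_nonpos (by positivity) hn' (by linarith)
            _ = 2 ^ (-δ * k) := by
                rw [← Real.rpow_natCast, ← Real.rpow_mul two_pos.le, mul_comm]
      _ = (∑ n ∈ Ioc (2 ^ k) (2 ^ (k + 1)), vonMangoldt n / n) * ρ ^ k := by rw [sum_mul]
      _ ≤ 11 * ρ ^ k := by
          gcongr
          exact sum_vonMangoldt_div_dyadic_le k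
  rw [sum_Ioc_two_pow_eq_sum_dyadic _ hJM]
  calc _ ≤ ∑ k ∈ Ico J M, 11 * ρ ^ k := sum_le_sum fun k _ => hblock k
    _ = 11 * ∑ k ∈ Ico J M, ρ ^ k := by rw [mul_sum]
    _ ≤ 11 * (ρ ^ J / (1 - ρ)) := by
        gcongr
        exact geom_sum_Ico_le_of_lt_one hρ0.le hρ1
    _ ≤ 11 * (ρ ^ J / (δ / 2)) := by gcongr
    _ = 22 * ρ ^ J / δ := by ring
    _ = _ := by
        rw [hρ, ← Real.rpow_natCast, ← Real.rpow_mul two_pos.le]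
        congr 3
        ring

theorem exists_sum_one_div_primes_ge :
    ∃ I₀ : ℕ, ∀ I ≥ I₀, (1 / 256 : ℝ) ≤
      ∑ p ∈ (Ioc (2 ^ I) (2 ^ (2048 * I))).filter (fun p : ℕ => p.Prime ∧ p % 8 = 7),
        (1 / p : ℝ) := by
  obtain ⟨C, hC⟩ := LSeries_residueClass_lower_bound (q := 8) (a := 7) (by decide)
  set a : ℕ → ℝ := residueClass (7 : ZMod 8) with ha
  have ha0 : ∀ n, 0 ≤ a n := residueClass_nonneg _
  have hale : ∀ n, a n ≤ vonMangoldt n := residueClass_le _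
  have hsum := summable_residueClass_non_primes_div (7 : ZMod 8)
  rw [← ha] at hsum
  set C₂ := ∑' n : ℕ, (if n.Prime then 0 else a n) / n with hC₂
  refine ⟨max 1 ⌈C + C₂⌉₊, fun I hI => ?_⟩
  have hI1 : 1 ≤ I := le_of_max_le_left hI
  have hI2 : C + C₂ ≤ I := Nat.ceil_le.mp (le_of_max_le_right hI)
  set J := 2048 * I with hJ
  have hIJ : I ≤ J := by omega
  have hJ0 : (0 : ℝ) < J := by
    have : 0 < J := by omega
    exact_mod_cast this
  have hJ8 : (8 : ℝ) ≤ J := by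
    have : 8 ≤ J := by omega
    exact_mod_cast this
  set δ : ℝ := 8 / J with hδ
  have hδ0 : 0 < δ := by positivity
  have hδ1 : δ ≤ 1 := (div_le_one hJ0).mpr hJ8
  set X := ∑ p ∈ (Ioc (2 ^ I) (2 ^ J)).filter (fun p : ℕ => p.Prime ∧ p % 8 = 7),
    (1 / p : ℝ) with hX
  have hmid : ∑ n ∈ Ioc (2 ^ I) (2 ^ J), a n / (n : ℝ) ≤ J * X + C₂ := by
    have h1 : ∑ n ∈ Ioc (2 ^ I) (2 ^ J), a n / (n : ℝ) =
        ∑ n ∈ (Ioc (2 ^ I) (2 ^ J) : Finset ℕ), (if n.Prime then a n else 0) / (n : ℝ) +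
        ∑ n ∈ (Ioc (2 ^ I) (2 ^ J) : Finset ℕ), (if n.Prime then 0 else a n) / (n : ℝ) := by
      rw [← sum_add_distrib]
      refine sum_congr rfl fun n _ => ?_
      split_ifs <;> simp
    rw [h1]
    refine add_le_add ?_ ?_
    · rw [hX, mul_sum, sum_filter]
      refine sum_le_sum fun n hn => ?_
      have hn2 : (n : ℝ) ≤ 2 ^ J := by exact_mod_cast (mem_Ioc.mp hn).2
      have hn1 : (1 : ℝ) ≤ n := by
        have : 1 ≤ n := Nat.one_le_two_pow.trans (mem_Ioc.mp hn).1.le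
        exact_mod_cast this
      by_cases hp : n.Prime
      · rw [if_pos hp]
        by_cases h7 : n % 8 = 7
        · rw [if_pos ⟨hp, h7⟩, mul_one_div]
          gcongr
          refine (hale n).trans ?_
          rw [vonMangoldt_apply_prime hp]
          calc Real.log n ≤ Real.log (2 ^ J) := Real.log_le_log (by linarith) hn2
            _ = J * Real.log 2 := Real.log_pow _ _
            _ ≤ J * 1 := by
                have := Real.log_two_lt_d9
                gcongr
                linarith
            _ = J := mul_one _
        · rw [if_neg (fun h => h7 h.2)]
          have : a n = 0 := by
            refine Set.indicator_of_notMem ?_ _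
            intro h
            have h' : ((n : ℕ) : ZMod 8) = ((7 : ℕ) : ZMod 8) := h
            rw [ZMod.natCast_eq_natCast_iff] at h'
            exact h7 h'
          rw [this, zero_div]
      · rw [if_neg hp, if_neg (fun h => hp h.1), zero_div]
    · refine hsum.sum_le_tsum _ fun n _ => ?_
      split_ifs
      · simp
      · exact div_nonneg (ha0 n) (Nat.cast_nonneg n)
  have hup : ∑' n, a n / (n : ℝ) ^ (1 + δ) ≤ 11 * I + (J * X + C₂) + 22 * (1 / 256) / δ := by
    refine Real.tsum_le_of_sum_range_le (fun n => div_nonneg (ha0 n) (by positivity)) fun n => ?_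
    have hrpow : ∀ n : ℕ, n ≠ 0 → a n / (n : ℝ) ^ (1 + δ) ≤ a n / n := by
      intro n hn
      have hn1 : (1 : ℝ) ≤ n := by exact_mod_cast Nat.one_le_iff_ne_zero.mpr hn
      refine div_le_div_of_nonneg_left (ha0 n) (by linarith) ?_
      exact Real.self_le_rpow_of_one_le hn1 (by linarith)
    have hM : J ≤ max J n := le_max_left _ _
    calc ∑ i ∈ range n, a i / (i : ℝ) ^ (1 + δ)
        ≤ ∑ i ∈ insert 0 (Ioc 0 (2 ^ max J n)), a i / (i : ℝ) ^ (1 + δ) := by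
          refine sum_le_sum_of_subset_of_nonneg (fun i hi => ?_)
            fun i _ _ => div_nonneg (ha0 i) (by positivity)
          have h1 := mem_range.mp hi
          have h2 : n ≤ 2 ^ max J n := (le_max_right J n).trans Nat.lt_two_pow_self.le
          rw [mem_insert, mem_Ioc]
          omega
      _ = ∑ i ∈ Ioc 0 (2 ^ max J n), a i / (i : ℝ) ^ (1 + δ) := by
          rw [sum_insert (by simp), ha, residueClass_apply_zero, zero_div, zero_add]
      _ = ∑ i ∈ Ioc 0 (2 ^ I), a i / (i : ℝ) ^ (1 + δ) +
          ∑ i ∈ Ioc (2 ^ I) (2 ^ J), a i / (i : ℝ) ^ (1 + δ) +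
          ∑ i ∈ Ioc (2 ^ J) (2 ^ max J n), a i / (i : ℝ) ^ (1 + δ) := by
          rw [sum_Ioc_consecutive _ (Nat.zero_le _) (Nat.pow_le_pow_right two_pos hIJ),
            sum_Ioc_consecutive _ (Nat.zero_le _) (Nat.pow_le_pow_right two_pos hM)]
      _ ≤ _ := by
          refine add_le_add (add_le_add ?_ ?_) ?_
          · refine le_trans (sum_le_sum fun i hi => ?_) (sum_vonMangoldt_div_le I)
            refine (hrpow i (mem_Ioc.mp hi).1.ne').trans ?_
            gcongr
            exact hale i
          · refine le_trans (sum_le_sum fun i hi => ?_) hmid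
            exact hrpow i ((Nat.zero_le _).trans_lt (mem_Ioc.mp hi).1).ne'
          · refine le_trans (sum_le_sum fun i _ => ?_)
              ((sum_vonMangoldt_div_rpow_tail_le hδ0 hδ1 hM).trans (le_of_eq ?_))
            · gcongr
              exact hale i
            · rw [hδ, mul_div_cancel₀ _ hJ0.ne', Real.rpow_neg two_pos.le]
              norm_num
  have hlow := hC (x := 1 + δ) ⟨by linarith, by linarith⟩
  have htot : Nat.totient 8 = 4 := by decide
  rw [htot, add_sub_cancel_left] at hlow
  have h := hlow.trans hup
  have hdiv : ∀ y : ℝ, y / δ = y * J / 8 := fun y => by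
    rw [hδ]
    field_simp
  rw [hdiv, hdiv] at h
  have hJI : (J : ℝ) = 2048 * I := by
    rw [hJ]
    push_cast
    ring
  push_cast at h
  have h5 : J * (1 / 256 : ℝ) ≤ J * X := by
    rw [hJI] at h ⊢
    linarith
  exact le_of_mul_le_mul_left h5 hJ0

end PrimesInProgression

section Assembly

open Finset

theorem pow_four_le_two_pow {k : ℕ} (hk : 16 ≤ k) : k ^ 4 ≤ 2 ^ k := by
  induction k, hk using Nat.le_induction with
  | base => norm_num
  | succ k hk ih =>
    have h : (k + 1) ^ 4 ≤ 2 * k ^ 4 := by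
      have h2 : 16 * k ^ 2 ≤ k * k ^ 2 := by gcongr
      have h3 : 16 * k ^ 3 ≤ k * k ^ 3 := by gcongr
      nlinarith
    calc (k + 1) ^ 4 ≤ 2 * k ^ 4 := h
      _ ≤ 2 * 2 ^ k := by gcongr
      _ = 2 ^ (k + 1) := by ring

theorem exists_sum_one_div_primes_ge_mul :
    ∃ r₀ : ℕ, ∀ r ≥ r₀, ∀ l : ℕ, (l / 256 : ℝ) ≤
      ∑ p ∈ (Ioc (2 ^ (12 * 2048 ^ r)) (2 ^ (12 * 2048 ^ (r + l)))).filter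
        (fun p : ℕ => p.Prime ∧ p % 8 = 7), (1 / p : ℝ) := by
  obtain ⟨I₀, hI₀⟩ := exists_sum_one_div_primes_ge
  refine ⟨I₀, fun r hr l => ?_⟩
  induction l with
  | zero => simp
  | succ l ih =>
    have hI : I₀ ≤ 12 * 2048 ^ (r + l) := by
      have h1 : r + l < 2048 ^ (r + l) := Nat.lt_pow_self (by norm_num)
      omega
    have h := hI₀ _ hI
    rw [show 2048 * (12 * 2048 ^ (r + l)) = 12 * 2048 ^ (r + (l + 1)) by ring] at h
    have hmono : ∀ i j : ℕ, i ≤ j → 2 ^ (12 * 2048 ^ i) ≤ 2 ^ (12 * 2048 ^ j) := fun i j hij =>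
      Nat.pow_le_pow_right two_pos
        (Nat.mul_le_mul_left _ (Nat.pow_le_pow_right (by norm_num) hij))
    rw [sum_filter] at h ih ⊢
    rw [← sum_Ioc_consecutive _ (hmono r (r + l) (by omega))
      (hmono (r + l) (r + (l + 1)) (by omega))]
    push_cast
    linarith

theorem card_mul_le_of_subset_setC :
    ∃ r₀ : ℕ, ∀ r ≥ r₀, ∀ (N : ℕ) (T : Finset ℕ), 2 ^ (48 * 2048 ^ (2 * r)) ≤ N →
      (∀ n ∈ T, n ∈ setC ∧ n ≤ N) → (#T * r : ℝ) ≤ 70000000 * N := by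
  obtain ⟨r₁, hr₁⟩ := exists_sum_one_div_primes_ge_mul
  refine ⟨max 1 r₁, fun r hr N T hN hT => ?_⟩
  have hr1 : 1 ≤ r := le_of_max_le_left hr
  have hS := hr₁ r (le_of_max_le_right hr) r
  rw [← two_mul] at hS
  set k := 2048 ^ r with hk
  have hk2 : 2048 ^ (2 * r) = k ^ 2 := by rw [hk, ← pow_mul, mul_comm]
  rw [hk2] at hS hN
  set P := (Ioc (2 ^ (12 * k)) (2 ^ (12 * k ^ 2))).filter
    (fun p : ℕ => p.Prime ∧ p % 8 = 7) with hP
  set S := ∑ p ∈ P, (1 / p : ℝ) with hSdef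
  have hk16 : 2048 ≤ k := by
    calc 2048 = 2048 ^ 1 := by norm_num
      _ ≤ k := Nat.pow_le_pow_right (by norm_num) hr1
  have hrk : r ≤ k := (Nat.lt_pow_self (by norm_num)).le
  have hr3 : 2 * r ^ 3 ≤ 12 * k := by
    have : r ^ 3 ≤ k := by
      calc r ^ 3 ≤ (2 ^ r) ^ 3 := by
            gcongr
            exact Nat.lt_two_pow_self.le
        _ = 8 ^ r := by rw [← pow_mul, mul_comm, pow_mul]; norm_num
        _ ≤ 2048 ^ r := by gcongr; norm_num
    omega
  have hmain := card_mul_sq_le (N := N) (z := 2 ^ (12 * k)) (Y := 2 ^ (12 * k ^ 2)) (G := 2 ^ k)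
    (m := r) (w := 2 ^ (2 * k)) (P := P) (T := T)
    (by
      calc 64 = 2 ^ 6 := by norm_num
        _ ≤ 2 ^ (12 * k) := Nat.pow_le_pow_right two_pos (by omega))
    (fun p hp => by
      obtain ⟨h1, h2, h3⟩ := mem_filter.mp hp
      exact ⟨h2, h3, mem_Ioc.mp h1⟩)
    hT (by positivity) (by positivity) (le_of_eq (by rw [← pow_mul]; ring_nf)) hr1
    (Nat.pow_le_pow_right two_pos hr3)
  rw [← hSdef] at hmain
  have hr0 : (0 : ℝ) < r := by exact_mod_cast hr1
  have hr1' : (1 : ℝ) ≤ r := by exact_mod_cast hr1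
  have hS0 : 0 < S := lt_of_lt_of_le (by positivity) hS
  have hkR : (2048 : ℝ) ≤ k := by exact_mod_cast hk16
  have hk4 : (k : ℝ) ^ 4 ≤ 2 ^ k := by exact_mod_cast pow_four_le_two_pow (by omega)
  have hlog0 : 0 ≤ Real.log ((2 ^ (12 * k ^ 2) : ℕ) : ℝ) := Real.log_natCast_nonneg _
  have hlog : 1 + Real.log ((2 ^ (12 * k ^ 2) : ℕ) : ℝ) ≤ 13 * k ^ 2 := by
    push_cast
    rw [Real.log_pow]
    have := Real.log_two_lt_d9
    have h1 : ((12 * k ^ 2 : ℕ) : ℝ) * Real.log 2 ≤ ((12 * k ^ 2 : ℕ) : ℝ) * 1 := by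
      gcongr
      linarith
    push_cast at h1 ⊢
    nlinarith
  have hlogsq : (1 + Real.log ((2 ^ (12 * k ^ 2) : ℕ) : ℝ)) ^ 2 / ((2 ^ k : ℕ) : ℝ) ≤ 169 := by
    rw [div_le_iff₀ (by positivity)]
    calc _ ≤ (13 * k ^ 2 : ℝ) ^ 2 := by gcongr
      _ = 169 * k ^ 4 := by ring
      _ ≤ 169 * ((2 ^ k : ℕ) : ℝ) := by
          push_cast
          gcongr
  have hlogz : (1 + Real.log ((2 ^ (12 * k ^ 2) : ℕ) : ℝ)) / ((2 ^ (12 * k) : ℕ) : ℝ) ≤ 169 := by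
    rw [div_le_iff₀ (by positivity)]
    calc _ ≤ (13 * k ^ 2 : ℝ) := hlog
      _ ≤ 169 * k ^ 4 := by nlinarith [sq_nonneg ((k : ℝ) ^ 2 - 1)]
      _ ≤ 169 * 2 ^ k := by gcongr
      _ ≤ 169 * ((2 ^ (12 * k) : ℕ) : ℝ) := by
          push_cast
          gcongr
          · norm_num
          · omega
  have hGw : (((2 ^ k : ℕ) : ℝ) / ((2 ^ (2 * k) : ℕ) : ℝ)) ≤ 1 / r := by
    rw [div_le_div_iff₀ (by positivity) hr0]
    have h1 : (r : ℝ) ≤ 2 ^ k := by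
      have : r ≤ 2 ^ k := hrk.trans Nat.lt_two_pow_self.le
      exact_mod_cast this
    push_cast
    rw [two_mul, pow_add, one_mul]
    gcongr
  have hY4 : (((2 ^ (12 * k ^ 2) : ℕ) : ℝ)) ^ 4 ≤ N := by
    have : (2 ^ (12 * k ^ 2)) ^ 4 ≤ N := by
      rw [← pow_mul]
      exact (le_of_eq (by ring_nf)).trans hN
    exact_mod_cast this
  have hY2 : (((2 ^ (12 * k ^ 2) : ℕ) : ℝ)) ^ 2 ≤ N := by
    refine le_trans (pow_le_pow_right₀ ?_ (by norm_num)) hY4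
    exact_mod_cast Nat.one_le_two_pow
  have hN0 : (0 : ℝ) ≤ N := Nat.cast_nonneg N
  have hε : (5 / r + ((2 ^ k : ℕ) : ℝ) / ((2 ^ (2 * k) : ℕ) : ℝ)) ≤ 6 / r := by
    calc _ ≤ (5 / r + 1 / r : ℝ) := by gcongr
      _ = 6 / r := by ring
  have hbound : #T * S ^ 2 ≤ 4 * N * S + 12 * N * S ^ 2 / r + 1020 * N := by
    calc _ ≤ _ := hmain
      _ ≤ 4 * N * S + 4 * N + 2 * N * (6 / r * S ^ 2 + 2 * 169 + 169) + 2 * N := by gcongr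
      _ = _ := by ring
  have hrS : (r : ℝ) ≤ 256 * S := by linarith
  have h1 : (r : ℝ) * S ≤ 256 * S ^ 2 := by nlinarith
  have h2 : (r : ℝ) ≤ 65536 * S ^ 2 := by nlinarith
  have h3 : (#T * r : ℝ) * S ^ 2 ≤ (70000000 * N) * S ^ 2 := by
    calc (#T * r : ℝ) * S ^ 2 = r * (#T * S ^ 2) := by ring
      _ ≤ r * (4 * N * S + 12 * N * S ^ 2 / r + 1020 * N) := by gcongr
      _ = 4 * N * (r * S) + 12 * N * S ^ 2 + 1020 * N * r := by
          field_simp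
      _ ≤ 4 * N * (256 * S ^ 2) + 12 * N * S ^ 2 + 1020 * N * (65536 * S ^ 2) := by gcongr
      _ = 66847756 * (N * S ^ 2) := by ring
      _ ≤ 70000000 * (N * S ^ 2) := by
          gcongr
          norm_num
      _ = _ := by ring
  exact le_of_mul_le_mul_right h3 (by positivity)

theorem two_pow_le_of_le_log_log {r : ℕ} {x : ℝ} (hr : 1 ≤ r) (hx : 1 < x)
    (h : 20 * r ≤ Real.log (Real.log x)) : (2 : ℝ) ^ (48 * 2048 ^ (2 * r)) ≤ x := by
  have hlog : 0 < Real.log x := Real.log_pos hx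
  have h1 : 48 * 2048 ^ (2 * r) ≤ 2 ^ (28 * r) := by
    calc 48 * 2048 ^ (2 * r) ≤ 2 ^ (6 * r) * 2048 ^ (2 * r) := by
          gcongr
          calc 48 ≤ 2 ^ 6 := by norm_num
            _ ≤ 2 ^ (6 * r) := Nat.pow_le_pow_right two_pos (by omega)
      _ = 2 ^ (28 * r) := by
          rw [show 2048 = 2 ^ 11 by norm_num, ← pow_mul, ← pow_add]
          ring_nf
  have h2 : (2 : ℝ) ^ (28 * r) ≤ Real.log x := by
    rw [← Real.exp_log hlog, ← Real.exp_log (show (0 : ℝ) < 2 ^ (28 * r) by positivity),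
      Real.exp_le_exp, Real.log_pow]
    have h3 := Real.log_two_lt_d9
    have h4 : (0 : ℝ) ≤ r := Nat.cast_nonneg r
    push_cast
    nlinarith
  rw [← Real.exp_log (show 0 < x by linarith),
    ← Real.exp_log (show (0 : ℝ) < 2 ^ (48 * 2048 ^ (2 * r)) by positivity), Real.exp_le_exp,
    Real.log_pow]
  calc ((48 * 2048 ^ (2 * r) : ℕ) : ℝ) * Real.log 2 ≤ ((2 ^ (28 * r) : ℕ) : ℝ) * 1 := by
        have := Real.log_two_lt_d9
        have := Real.log_pos one_lt_two
        gcongr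
        linarith
    _ ≤ Real.log x := by
        push_cast
        linarith

theorem exists_ncard_setC_le :
    ∃ C : ℝ, 0 < C ∧ ∀ x : ℝ, x > Real.exp (Real.exp 1) →
      ({n : ℕ | n ∈ setC ∧ (n : ℝ) ≤ x}.ncard : ℝ) ≤ C * x / Real.log (Real.log x) := by
  obtain ⟨r₀, hr₀⟩ := card_mul_le_of_subset_setC
  set R := max 1 r₀ with hR
  refine ⟨2800000000 + 20 * R, by positivity, fun x hx => ?_⟩
  have hx1 : 1 < x := (Real.one_lt_exp_iff.mpr (Real.exp_pos 1)).trans hx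
  have hx0 : 0 < x := by linarith
  have hlog1 : Real.exp 1 < Real.log x := (Real.lt_log_iff_exp_lt hx0).mpr hx
  have hL1 : 1 < Real.log (Real.log x) :=
    (Real.lt_log_iff_exp_lt ((Real.exp_pos 1).trans hlog1)).mpr hlog1
  set L := Real.log (Real.log x) with hL
  have hsub : {n : ℕ | n ∈ setC ∧ (n : ℝ) ≤ x} ⊆ (Ioc 0 ⌊x⌋₊ : Finset ℕ) := by
    intro n hn
    rw [mem_coe, mem_Ioc]
    exact ⟨hn.1.1, Nat.le_floor hn.2⟩
  have hfin : {n : ℕ | n ∈ setC ∧ (n : ℝ) ≤ x}.Finite := (finite_toSet _).subset hsub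
  have hfloor : ((⌊x⌋₊ : ℕ) : ℝ) ≤ x := Nat.floor_le hx0.le
  rw [le_div_iff₀ (by linarith)]
  rcases le_or_gt (20 * R : ℝ) L with h | h
  · set r := ⌊L / 20⌋₊ with hr
    have hRr : R ≤ r := Nat.le_floor (by linarith)
    have hr1 : 1 ≤ r := (le_max_left 1 r₀).trans hRr
    have hrL : 20 * r ≤ L := by
      have := Nat.floor_le (show 0 ≤ L / 20 by linarith)
      linarith
    have hLr : L ≤ 40 * r := by
      have h1 := Nat.lt_floor_add_one (L / 20)
      have h2 : (1 : ℝ) ≤ r := by exact_mod_cast hr1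
      rw [← hr] at h1
      linarith
    have hN : 2 ^ (48 * 2048 ^ (2 * r)) ≤ ⌊x⌋₊ := by
      refine Nat.le_floor ?_
      push_cast
      exact two_pow_le_of_le_log_log hr1 hx1 hrL
    have hT := hr₀ r ((le_max_right 1 r₀).trans hRr) ⌊x⌋₊ hfin.toFinset hN (fun n hn => by
      have := hfin.mem_toFinset.mp hn
      exact ⟨this.1, Nat.le_floor this.2⟩)
    rw [← Set.ncard_eq_toFinset_card _ hfin] at hT
    set c : ℝ := ({n : ℕ | n ∈ setC ∧ (n : ℝ) ≤ x}.ncard : ℝ)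
    have hc : 0 ≤ c := Nat.cast_nonneg _
    calc c * L ≤ c * (40 * r) := by gcongr
      _ = 40 * (c * r) := by ring
      _ ≤ 40 * (70000000 * ⌊x⌋₊) := by gcongr
      _ ≤ 40 * (70000000 * x) := by gcongr
      _ = 2800000000 * x := by ring
      _ ≤ (2800000000 + 20 * R) * x := by
          gcongr
          have : (0 : ℝ) ≤ 20 * R := by positivity
          linarith
  · have hcard : ({n : ℕ | n ∈ setC ∧ (n : ℝ) ≤ x}.ncard : ℝ) ≤ x := by
      have h1 := Set.ncard_le_ncard hsub (finite_toSet _)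
      rw [Set.ncard_coe_finset, Nat.card_Ioc, Nat.sub_zero] at h1
      exact le_trans (by exact_mod_cast h1) hfloor
    calc _ ≤ x * (20 * R) := by gcongr
      _ ≤ (2800000000 + 20 * R) * x := by nlinarith

end Assembly

/-- Theorem 6 of the paper: `#𝒞(x) ≪ x/(log log x)^(1/7)` for `x > e^e`; in
particular `𝒞` has asymptotic density zero. -/
theorem setC_count_bound :
    (∃ C : ℝ, 0 < C ∧ ∀ x : ℝ, x > Real.exp (Real.exp 1) →
      ({n : ℕ | n ∈ setC ∧ (n : ℝ) ≤ x}.ncard : ℝ) ≤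
        C * x / (Real.log (Real.log x)) ^ ((1 : ℝ) / 7)) ∧
    Tendsto (fun x : ℝ => ({n : ℕ | n ∈ setC ∧ (n : ℝ) ≤ x}.ncard : ℝ) / x)
      atTop (nhds 0) := by
  obtain ⟨C, hC, hbound⟩ := exists_ncard_setC_le
  have hL1 : ∀ x : ℝ, x > Real.exp (Real.exp 1) → 1 < Real.log (Real.log x) := fun x hx => by
    have hx0 : 0 < x := (Real.exp_pos _).trans hx
    have hlog1 : Real.exp 1 < Real.log x := (Real.lt_log_iff_exp_lt hx0).mpr hx
    exact (Real.lt_log_iff_exp_lt ((Real.exp_pos 1).trans hlog1)).mpr hlog1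
  refine ⟨⟨C, hC, fun x hx => ?_⟩, ?_⟩
  · have hx0 : 0 < x := (Real.exp_pos _).trans hx
    have h1 := hL1 x hx
    have h2 : Real.log (Real.log x) ^ ((1 : ℝ) / 7) ≤ Real.log (Real.log x) :=
      Real.rpow_le_self_of_one_le h1.le (by norm_num)
    have h3 : 0 < Real.log (Real.log x) ^ ((1 : ℝ) / 7) := Real.rpow_pos_of_pos (by linarith) _
    exact (hbound x hx).trans (div_le_div_of_nonneg_left (by positivity) h3 h2)
  · have hlim : Tendsto (fun x : ℝ => C / Real.log (Real.log x)) atTop (nhds 0) :=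
      tendsto_const_nhds.div_atTop (Real.tendsto_log_atTop.comp Real.tendsto_log_atTop)
    refine squeeze_zero' ?_ ?_ hlim
    · filter_upwards [eventually_gt_atTop 0] with x hx
      positivity
    · filter_upwards [eventually_gt_atTop (Real.exp (Real.exp 1))] with x hx
      have hx0 : 0 < x := (Real.exp_pos _).trans hx
      rw [div_le_iff₀ hx0]
      refine (hbound x hx).trans (le_of_eq ?_)
      ring
end

section
/- For every real number t ≥ 1, the number of odd primes p ≤ t such that the multiplicative order of 2 modulo p is at most p^{1/3} is at most t^{2/3}. -/
theorem card_primeFactors_prod_two_pow_sub_one_le (N : ℕ) :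
    (∏ k ∈ Finset.Icc 1 N, (2 ^ k - 1)).primeFactors.card ≤ N * N := by
  set M := ∏ k ∈ Finset.Icc 1 N, (2 ^ k - 1) with hM
  have hM_pos : 0 < M := Finset.prod_pos fun k hk => by
    have := Nat.one_lt_two_pow (n := k) (by grind)
    omega
  have hlower : 2 ^ M.primeFactors.card ≤ M :=
    (Finset.pow_card_le_prod _ _ _ fun p hp => (Nat.prime_of_mem_primeFactors hp).two_le).trans
      (Nat.le_of_dvd hM_pos (Nat.prod_primeFactors_dvd M))
  have hupper : M ≤ 2 ^ (N * N) := by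
    calc M ≤ ∏ _k ∈ Finset.Icc 1 N, 2 ^ N := Finset.prod_le_prod' fun k hk =>
          (Nat.sub_le _ _).trans (Nat.pow_le_pow_right two_pos (Finset.mem_Icc.mp hk).2)
      _ = 2 ^ (N * N) := by simp [pow_mul]
  exact (Nat.pow_le_pow_iff_right one_lt_two).mp (hlower.trans hupper)

theorem dvd_prod_two_pow_sub_one_of_orderOf_le {p N : ℕ} (hp : p.Prime) (hodd : Odd p)
    (h : orderOf (2 : ZMod p) ≤ N) :
    p ∣ ∏ k ∈ Finset.Icc 1 N, (2 ^ k - 1) := by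
  have : Fact p.Prime := ⟨hp⟩
  have h2 : (2 : ZMod p) ≠ 0 := fun h0 => by
    have h02 : p ∣ 2 := (ZMod.natCast_eq_zero_iff 2 p).mp (by exact_mod_cast h0)
    rw [(Nat.prime_dvd_prime_iff_eq hp Nat.prime_two).mp h02] at hodd
    exact absurd hodd (by decide)
  have hpos : 0 < orderOf (2 : ZMod p) :=
    orderOf_pos_iff.mpr (isOfFinOrder_iff_pow_eq_one.mpr
      ⟨p - 1, Nat.sub_pos_of_lt hp.one_lt, ZMod.pow_card_sub_one_eq_one h2⟩)
  have hdvd : p ∣ 2 ^ orderOf (2 : ZMod p) - 1 := by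
    rw [← ZMod.natCast_eq_zero_iff, Nat.cast_sub Nat.one_le_two_pow]
    simp [pow_orderOf_eq_one]
  exact hdvd.trans (Finset.dvd_prod_of_mem _ (Finset.mem_Icc.mpr ⟨hpos, h⟩))

/-- Estimate \eqref{eq:Q1} of the paper: for every real `t ≥ 1`, the number of odd
primes `p ≤ t` whose multiplicative order of `2` modulo `p` is at most `p^(1/3)`
is at most `t^(2/3)`. -/
theorem count_primes_small_order_le
    (t : ℝ) (ht : 1 ≤ t) :
    ({p : ℕ | p.Prime ∧ Odd p ∧ (p : ℝ) ≤ t ∧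
        ((orderOf (2 : ZMod p) : ℝ) ≤ (p : ℝ) ^ ((1 : ℝ) / 3))}.ncard : ℝ) ≤
      t ^ ((2 : ℝ) / 3) := by
  set N := ⌊t ^ ((1 : ℝ) / 3)⌋₊ with hN
  have ht0 : 0 ≤ t := zero_le_one.trans ht
  have hsub : {p : ℕ | p.Prime ∧ Odd p ∧ (p : ℝ) ≤ t ∧
      ((orderOf (2 : ZMod p) : ℝ) ≤ (p : ℝ) ^ ((1 : ℝ) / 3))} ⊆
      ((∏ k ∈ Finset.Icc 1 N, (2 ^ k - 1)).primeFactors : Set ℕ) := by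
    rintro p ⟨hp, hodd, hpt, hord⟩
    have hle : orderOf (2 : ZMod p) ≤ N :=
      Nat.le_floor (hord.trans (Real.rpow_le_rpow p.cast_nonneg hpt (by norm_num)))
    refine Nat.mem_primeFactors.mpr
      ⟨hp, dvd_prod_two_pow_sub_one_of_orderOf_le hp hodd hle, ?_⟩
    refine Finset.prod_ne_zero_iff.mpr fun k hk => ?_
    have := Nat.one_lt_two_pow (n := k) (by grind)
    omega
  have hcard := Set.ncard_le_ncard hsub (Finset.finite_toSet _)
  rw [Set.ncard_coe_finset] at hcard
  have hfloor : (N : ℝ) ≤ t ^ ((1 : ℝ) / 3) := Nat.floor_le (Real.rpow_nonneg ht0 _)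
  calc _ ≤ ((N * N : ℕ) : ℝ) :=
        Nat.cast_le.mpr (hcard.trans (card_primeFactors_prod_two_pow_sub_one_le N))
    _ ≤ t ^ ((1 : ℝ) / 3) * t ^ ((1 : ℝ) / 3) := by
        rw [Nat.cast_mul]
        gcongr
    _ = t ^ ((2 : ℝ) / 3) := by
        rw [← Real.rpow_add (zero_lt_one.trans_le ht)]
        norm_num
end
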